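/- arXiv:1511.00192 — 4 statements merged into one kernel-verified Lean document; each statement's English description precedes it below -/
import Mathlib

section
/- Let k ≥ 4 and let δ be a set partition of [k] having exactly one block of size 2 and all other blocks singletons. Then for every n > k, |Π_n(δ)| < |Π_n(σ_k)| < |Π_n(β_k)|, where σ_k is the set partition of [k] all of whose blocks are singletons and β_k is the set partition of [k] with the single block [k]. -/
open Finset

/-- The ground set `[n] = {1, …, n}`. -/
def Idx (n : ℕ) : Finset ℕ := Finset.Icc 1 n

/-- `i` and `j` lie in the same block of the set partition `π`. -/
def SameBlock {n : ℕ} (π : Finpartition (Idx n)) (i j : ℕ) : Prop :=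
  ∃ B ∈ π.parts, i ∈ B ∧ j ∈ B

/-- Klazar containment: `σ ⊢ [n]` contains `τ ⊢ [k]` if there is a strictly increasing
map `f : [k] → [n]` such that `i, j` are in the same block of `τ` iff `f i, f j` are in
the same block of `σ`. -/
def Contains {k n : ℕ} (τ : Finpartition (Idx k)) (σ : Finpartition (Idx n)) : Prop :=
  ∃ f : ℕ → ℕ, StrictMonoOn f (Idx k) ∧ (∀ i ∈ Idx k, f i ∈ Idx n) ∧
    ∀ i ∈ Idx k, ∀ j ∈ Idx k, (SameBlock τ i j ↔ SameBlock σ (f i) (f j))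

/-- `σ` avoids the pattern `τ`. -/
def Avoids {k n : ℕ} (σ : Finpartition (Idx n)) (τ : Finpartition (Idx k)) : Prop :=
  ¬ Contains τ σ

/-- `|Π_n(τ)|`, the number of set partitions of `[n]` avoiding `τ`. -/
noncomputable def avoidCount (n : ℕ) {k : ℕ} (τ : Finpartition (Idx k)) : ℕ :=
  Nat.card {σ : Finpartition (Idx n) // Avoids σ τ}


noncomputable section SetPartitionFamilies

open scoped Classical

/-- `P` is the family of blocks of a set partition of `s`. -/
structure IsPartitionOf (s : Finset ℕ) (P : Finset (Finset ℕ)) : Prop where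
  nonempty : ∀ B ∈ P, B.Nonempty
  sub : ∀ B ∈ P, B ⊆ s
  cover : ∀ x ∈ s, ∃ B ∈ P, x ∈ B
  disj : ∀ B ∈ P, ∀ C ∈ P, ∀ x, x ∈ B → x ∈ C → B = C

/-- All set partitions of `s`, as families of blocks. -/
def setParts (s : Finset ℕ) : Finset (Finset (Finset ℕ)) :=
  s.powerset.powerset.filter (IsPartitionOf s)

lemma mem_setParts {s : Finset ℕ} {P : Finset (Finset ℕ)} :
    P ∈ setParts s ↔ IsPartitionOf s P := by
  simp only [setParts, mem_filter, mem_powerset, and_iff_right_iff_imp]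
  intro h B hB
  exact mem_powerset.2 (h.sub B hB)

lemma IsPartitionOf.union {s t : Finset ℕ} {P Q : Finset (Finset ℕ)}
    (hP : IsPartitionOf s P) (hQ : IsPartitionOf t Q) (hst : Disjoint s t) :
    IsPartitionOf (s ∪ t) (P ∪ Q) := by
  have hd : ∀ x ∈ s, x ∉ t := fun x hx hx' => Finset.disjoint_left.1 hst hx hx'
  refine ⟨?_, ?_, ?_, ?_⟩
  · intro B hB
    rcases mem_union.1 hB with h | h
    exacts [hP.nonempty B h, hQ.nonempty B h]
  · intro B hB
    rcases mem_union.1 hB with h | h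
    exacts [(hP.sub B h).trans subset_union_left, (hQ.sub B h).trans subset_union_right]
  · intro x hx
    rcases mem_union.1 hx with h | h
    · obtain ⟨B, hB, hx⟩ := hP.cover x h
      exact ⟨B, mem_union_left _ hB, hx⟩
    · obtain ⟨B, hB, hx⟩ := hQ.cover x h
      exact ⟨B, mem_union_right _ hB, hx⟩
  · intro B hB C hC x hxB hxC
    rcases mem_union.1 hB with h | h <;> rcases mem_union.1 hC with h' | h'
    · exact hP.disj B h C h' x hxB hxC
    · exact absurd (hQ.sub C h' hxC) (hd x (hP.sub B h hxB))
    · exact absurd (hQ.sub B h hxB) (hd x (hP.sub C h' hxC))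
    · exact hQ.disj B h C h' x hxB hxC

lemma isPartitionOf_singleton {B : Finset ℕ} (hB : B.Nonempty) : IsPartitionOf B {B} := by
  refine ⟨?_, ?_, ?_, ?_⟩ <;> simp_all

lemma isPartitionOf_image_singleton (s : Finset ℕ) :
    IsPartitionOf s (s.image fun x => {x}) := by
  refine ⟨?_, ?_, ?_, ?_⟩ <;> simp

lemma IsPartitionOf.insertBlock {s B : Finset ℕ} {Q : Finset (Finset ℕ)}
    (hQ : IsPartitionOf (s \ B) Q) (hBs : B ⊆ s) (hB : B.Nonempty) :
    IsPartitionOf s (insert B Q) := by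
  have := (isPartitionOf_singleton hB).union hQ disjoint_sdiff
  rwa [union_sdiff_of_subset hBs, ← insert_eq] at this

lemma IsPartitionOf.eraseBlock {s B : Finset ℕ} {P : Finset (Finset ℕ)}
    (hP : IsPartitionOf s P) (hB : B ∈ P) : IsPartitionOf (s \ B) (P.erase B) := by
  refine ⟨fun C hC => hP.nonempty C (mem_of_mem_erase hC), ?_, ?_, ?_⟩
  · intro C hC x hx
    rw [mem_erase] at hC
    refine mem_sdiff.2 ⟨hP.sub C hC.2 hx, fun hxB => hC.1 ?_⟩
    exact hP.disj C hC.2 B hB x hx hxB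
  · intro x hx
    rw [mem_sdiff] at hx
    obtain ⟨C, hC, hxC⟩ := hP.cover x hx.1
    exact ⟨C, mem_erase.2 ⟨fun h => hx.2 (h ▸ hxC), hC⟩, hxC⟩
  · intro C hC D hD
    exact hP.disj C (mem_of_mem_erase hC) D (mem_of_mem_erase hD)

lemma IsPartitionOf.notMem {s B : Finset ℕ} {Q : Finset (Finset ℕ)}
    (hQ : IsPartitionOf (s \ B) Q) (hB : B.Nonempty) : B ∉ Q := by
  intro h
  obtain ⟨x, hx⟩ := hB
  exact (mem_sdiff.1 (hQ.sub B h hx)).2 hx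

lemma setParts_empty : setParts ∅ = {∅} := by
  ext P
  rw [mem_setParts, mem_singleton]
  constructor
  · intro h
    refine eq_empty_of_forall_notMem fun B hB => ?_
    obtain ⟨x, hx⟩ := h.nonempty B hB
    exact notMem_empty _ (h.sub B hB hx)
  · rintro rfl
    refine ⟨?_, ?_, ?_, ?_⟩ <;> simp

/-- Classify the set partitions of `s` by the block containing `m`. -/
lemma card_filter_setParts {s : Finset ℕ} {m : ℕ} (hm : m ∈ s)
    (p : Finset (Finset ℕ) → Prop) [DecidablePred p] :
    ((setParts s).filter p).card =
      ∑ B ∈ s.powerset.filter (fun B => m ∈ B),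
        ((setParts (s \ B)).filter fun Q => p (insert B Q)).card := by
  rw [← card_sigma]
  symm
  refine card_bij (fun a _ => insert a.1 a.2) ?_ ?_ ?_
  · rintro ⟨B, Q⟩ h
    simp only [mem_sigma, mem_filter, mem_powerset, mem_setParts] at h ⊢
    exact ⟨h.2.1.insertBlock h.1.1 ⟨m, h.1.2⟩, h.2.2⟩
  · rintro ⟨B, Q⟩ h ⟨B', Q'⟩ h' heq
    simp only [mem_sigma, mem_filter, mem_powerset, mem_setParts] at h h' heq
    have hP := h.2.1.insertBlock h.1.1 ⟨m, h.1.2⟩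
    have hBB : B = B' := hP.disj B (mem_insert_self _ _) B'
      (heq ▸ mem_insert_self _ _) m h.1.2 h'.1.2
    subst hBB
    have hQ : Q = Q' := by
      rw [← erase_insert (h.2.1.notMem ⟨m, h.1.2⟩), heq,
        erase_insert (h'.2.1.notMem ⟨m, h.1.2⟩)]
    rw [hQ]
  · intro P hP
    simp only [mem_filter, mem_setParts] at hP
    obtain ⟨B, hB, hmB⟩ := hP.1.cover m hm
    refine ⟨⟨B, P.erase B⟩, ?_, insert_erase hB⟩
    simp only [mem_sigma, mem_filter, mem_powerset, mem_setParts, insert_erase hB]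
    exact ⟨⟨hP.1.sub B hB, hmB⟩, hP.1.eraseBlock hB, hP.2⟩

/-- Set partitions of `s` with at most `q` blocks. -/
def fewBlocks (s : Finset ℕ) (q : ℕ) : Finset (Finset (Finset ℕ)) :=
  (setParts s).filter fun P => P.card ≤ q

/-- Set partitions of `s` all of whose blocks have at most `q` elements. -/
def smallBlocks (s : Finset ℕ) (q : ℕ) : Finset (Finset (Finset ℕ)) :=
  (setParts s).filter fun P => ∀ B ∈ P, B.card ≤ q

lemma card_fewBlocks_succ {s : Finset ℕ} {m : ℕ} (hm : m ∈ s) (q : ℕ) :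
    (fewBlocks s (q + 1)).card =
      ∑ B ∈ s.powerset.filter (fun B => m ∈ B), (fewBlocks (s \ B) q).card := by
  rw [fewBlocks, card_filter_setParts hm]
  refine sum_congr rfl fun B hB => ?_
  rw [fewBlocks]
  congr 1
  refine filter_congr fun Q hQ => ?_
  rw [card_insert_of_notMem ((mem_setParts.1 hQ).notMem ⟨m, (mem_filter.1 hB).2⟩)]
  omega

/-- A set containing `m` splits into blocks of size `q + 1`, and a block around `m` of size
at most `q + 1`. -/
lemma exists_chunks (q m : ℕ) (B : Finset ℕ) (hm : m ∈ B) :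
    ∃ P, IsPartitionOf B P ∧ ∀ C ∈ P, C.card ≤ q + 1 ∧ (C.card = q + 1 ∨ m ∈ C) := by
  induction B using Finset.strongInduction with
  | H B ih =>
    by_cases hB : B.card ≤ q + 1
    · exact ⟨{B}, isPartitionOf_singleton ⟨m, hm⟩, by simp [hB, hm]⟩
    · have h1 : q + 1 ≤ (B.erase m).card := by
        rw [card_erase_of_mem hm]; omega
      obtain ⟨C, hC, hCc⟩ := exists_subset_card_eq h1
      have hCne : C.Nonempty := card_pos.1 (by omega)
      have hCB : C ⊆ B := hC.trans (erase_subset _ _)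
      have hmC : m ∉ C := fun h => by simpa using hC h
      obtain ⟨P, hP, hP'⟩ := ih (B \ C) (sdiff_ssubset hCB hCne) (mem_sdiff.2 ⟨hm, hmC⟩)
      refine ⟨insert C P, hP.insertBlock hCB hCne, ?_⟩
      intro D hD
      rcases mem_insert.1 hD with rfl | h
      · exact ⟨hCc.le, Or.inl hCc⟩
      · exact hP' D h

/-- Adjoining the chunks of `B` to a partition of `s \ B` into blocks of size at most `q`,
for `B` running over the subsets of `s` containing `m`, is injective. -/
lemma chunks_union_inj {s B B' : Finset ℕ} {m q : ℕ} {P P' Q Q' : Finset (Finset ℕ)}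
    (hB : m ∈ B) (hB' : m ∈ B')
    (hP : IsPartitionOf B P) (hP' : IsPartitionOf B' P')
    (hPc : ∀ C ∈ P, C.card = q + 1 ∨ m ∈ C) (hPc' : ∀ C ∈ P', C.card = q + 1 ∨ m ∈ C)
    (hQ : IsPartitionOf (s \ B) Q) (hQ' : IsPartitionOf (s \ B') Q')
    (hQc : ∀ C ∈ Q, C.card ≤ q) (hQc' : ∀ C ∈ Q', C.card ≤ q)
    (h : P ∪ Q = P' ∪ Q') : B = B' ∧ P = P' ∧ Q = Q' := by
  have key : ∀ {B : Finset ℕ} {P Q : Finset (Finset ℕ)}, m ∈ B →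
      (∀ C ∈ P, C.card = q + 1 ∨ m ∈ C) → IsPartitionOf (s \ B) Q →
      (∀ C ∈ Q, C.card ≤ q) →
      P = (P ∪ Q).filter (fun C => C.card = q + 1 ∨ m ∈ C) ∧
      Q = (P ∪ Q).filter (fun C => ¬ (C.card = q + 1 ∨ m ∈ C)) := by
    intro B P Q hB hPc hQ hQc
    have hQn : ∀ C ∈ Q, ¬ (C.card = q + 1 ∨ m ∈ C) := by
      rintro C hC (h | h)
      · have := hQc C hC; omega
      · exact (mem_sdiff.1 (hQ.sub C hC h)).2 hB
    constructor
    · ext C; simp only [mem_filter, mem_union]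
      constructor
      · exact fun hC => ⟨Or.inl hC, hPc C hC⟩
      · rintro ⟨h | h, h'⟩
        exacts [h, absurd h' (hQn C h)]
    · ext C; simp only [mem_filter, mem_union]
      constructor
      · exact fun hC => ⟨Or.inr hC, hQn C hC⟩
      · rintro ⟨h | h, h'⟩
        exacts [absurd (hPc C h) h', h]
  have k1 := key hB hPc hQ hQc
  have k2 := key hB' hPc' hQ' hQc'
  have hPP : P = P' := by rw [k1.1, k2.1, h]
  have hQQ : Q = Q' := by rw [k1.2, k2.2, h]
  refine ⟨?_, hPP, hQQ⟩
  subst hPP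
  ext x
  constructor
  · intro hx
    obtain ⟨C, hC, hxC⟩ := hP.cover x hx
    exact hP'.sub C hC hxC
  · intro hx
    obtain ⟨C, hC, hxC⟩ := hP'.cover x hx
    exact hP.sub C hC hxC

/-- The image `I` of the chunk construction lies in `smallBlocks s (q + 1)`, has one element for
each choice of the block `B` of `m` and of the rest, and contains only one splitting of each `B`. -/
lemma exists_image_chunks (s : Finset ℕ) (m q : ℕ) :
    ∃ I ⊆ smallBlocks s (q + 1),
      I.card = ∑ B ∈ s.powerset.filter (fun B => m ∈ B), (smallBlocks (s \ B) q).card ∧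
      ∀ B ⊆ s, m ∈ B → ∀ P P' Q, IsPartitionOf B P → IsPartitionOf B P' →
        (∀ C ∈ P, C.card = q + 1 ∨ m ∈ C) → (∀ C ∈ P', C.card = q + 1 ∨ m ∈ C) →
        Q ∈ smallBlocks (s \ B) q → P ∪ Q ∈ I → P' ∪ Q ∈ I → P = P' := by
  choose! ch hch using fun B => exists_chunks q m B
  refine ⟨((s.powerset.filter (fun B => m ∈ B)).sigma fun B => smallBlocks (s \ B) q).image
    fun a => ch a.1 ∪ a.2, ?_, ?_, ?_⟩
  · intro R hR
    simp only [mem_image, mem_sigma, mem_filter, mem_powerset, smallBlocks, mem_setParts] at hR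
    obtain ⟨⟨B, Q⟩, ⟨⟨hBs, hB⟩, hQ, hQc⟩, rfl⟩ := hR
    simp only [smallBlocks, mem_filter, mem_setParts]
    dsimp only at *
    refine ⟨?_, ?_⟩
    · have := (hch B hB).1.union hQ disjoint_sdiff
      rwa [union_sdiff_of_subset hBs] at this
    · intro C hC
      rcases mem_union.1 hC with h | h
      · exact ((hch B hB).2 C h).1
      · exact (hQc C h).trans (Nat.le_succ q)
  · rw [card_image_of_injOn, card_sigma]
    rintro ⟨B, Q⟩ h ⟨B', Q'⟩ h' heq
    simp only [coe_sigma, Set.mem_sigma_iff, mem_coe, mem_filter, mem_powerset, smallBlocks,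
      mem_setParts] at h h' heq
    obtain ⟨rfl, -, rfl⟩ := chunks_union_inj h.1.2 h'.1.2 (hch B h.1.2).1 (hch B' h'.1.2).1
      (fun C hC => ((hch B h.1.2).2 C hC).2) (fun C hC => ((hch B' h'.1.2).2 C hC).2)
      h.2.1 h'.2.1 h.2.2 h'.2.2 heq
    rfl
  · intro B hBs hB P P' Q hP hP' hPc hPc' hQ h h'
    have key : ∀ P, IsPartitionOf B P → (∀ C ∈ P, C.card = q + 1 ∨ m ∈ C) →
        P ∪ Q ∈ ((s.powerset.filter (fun B => m ∈ B)).sigma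
          fun B => smallBlocks (s \ B) q).image (fun a => ch a.1 ∪ a.2) → P = ch B := by
      intro P hP hPc hPQ
      simp only [mem_image, mem_sigma, mem_filter, mem_powerset, smallBlocks,
        mem_setParts] at hPQ hQ
      obtain ⟨⟨B', Q'⟩, ⟨⟨hBs', hB'⟩, hQ', hQc'⟩, heq⟩ := hPQ
      dsimp only at *
      obtain ⟨rfl, h, -⟩ := chunks_union_inj hB' hB (hch B' hB').1 hP
        (fun C hC => ((hch B' hB').2 C hC).2) hPc hQ' hQ.1 hQc' hQ.2 heq
      exact h.symm
    rw [key P hP hPc h, key P' hP' hPc' h']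

lemma card_fewBlocks_le_card_smallBlocks (s : Finset ℕ) (q : ℕ) :
    (fewBlocks s q).card ≤ (smallBlocks s q).card := by
  induction q generalizing s with
  | zero =>
    refine card_le_card fun P hP => ?_
    simp only [fewBlocks, smallBlocks, mem_filter, nonpos_iff_eq_zero, card_eq_zero] at hP ⊢
    obtain ⟨hP, rfl⟩ := hP
    exact ⟨hP, by simp⟩
  | succ q ih =>
    rcases s.eq_empty_or_nonempty with rfl | ⟨m, hm⟩
    · refine card_le_card fun P hP => ?_
      simp only [fewBlocks, smallBlocks, mem_filter, setParts_empty, mem_singleton] at hP ⊢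
      obtain ⟨rfl, -⟩ := hP
      exact ⟨rfl, by simp⟩
    · obtain ⟨I, hI, hIc, -⟩ := exists_image_chunks s m q
      rw [card_fewBlocks_succ hm]
      exact ((sum_le_sum fun B _ => ih (s \ B)).trans hIc.ge).trans (card_le_card hI)

lemma card_fewBlocks_lt_card_smallBlocks {s : Finset ℕ} {q : ℕ} (hq : 1 ≤ q)
    (hs : q + 3 ≤ s.card) : (fewBlocks s (q + 1)).card < (smallBlocks s (q + 1)).card := by
  obtain ⟨m, hm⟩ : s.Nonempty := card_pos.1 (by omega)
  obtain ⟨I, hI, hIc, hsep⟩ := exists_image_chunks s m q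
  rw [card_fewBlocks_succ hm]
  refine ((sum_le_sum fun B _ => card_fewBlocks_le_card_smallBlocks (s \ B) q).trans
    hIc.ge).trans_lt (card_lt_card (hI.ssubset_of_ne ?_))
  rintro rfl
  obtain ⟨J, hJ, hJc⟩ := exists_subset_card_eq
    (show q + 2 ≤ (s.erase m).card by rw [card_erase_of_mem hm]; omega)
  have hmJ : m ∉ J := fun h => by simpa using hJ h
  have hJs : J ⊆ s := hJ.trans (erase_subset _ _)
  set B := insert m J with hBdef
  have hBs : B ⊆ s := insert_subset hm hJs
  have hmB : m ∈ B := mem_insert_self _ _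
  set Q : Finset (Finset ℕ) := (s \ B).image fun x => {x} with hQdef
  have hQ : IsPartitionOf (s \ B) Q := isPartitionOf_image_singleton _
  have hQc : ∀ C ∈ Q, C.card ≤ q := by
    intro C hC
    obtain ⟨x, -, rfl⟩ := mem_image.1 hC
    simpa using hq
  have hpart : ∀ i ∈ J, IsPartitionOf B {{m, i}, J.erase i} := by
    intro i hi
    have h1 : ({m, i} : Finset ℕ) ⊆ B := by
      intro x hx
      rcases mem_insert.1 hx with rfl | hx
      · exact hmB
      · exact mem_insert_of_mem (mem_singleton.1 hx ▸ hi)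
    have h2 : B \ {m, i} = J.erase i := by
      ext x; simp only [hBdef, mem_sdiff, mem_insert, mem_singleton, mem_erase]
      constructor
      · tauto
      · rintro ⟨hxi, hxJ⟩
        exact ⟨Or.inr hxJ, by rintro (rfl | rfl) <;> tauto⟩
    refine IsPartitionOf.insertBlock ?_ h1 ⟨m, by simp⟩
    rw [h2]
    exact isPartitionOf_singleton (card_pos.1 (by rw [card_erase_of_mem hi]; omega))
  have hchunk : ∀ i ∈ J, ∀ C ∈ ({{m, i}, J.erase i} : Finset (Finset ℕ)),
      C.card = q + 1 ∨ m ∈ C := by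
    intro i hi C hC
    rcases mem_insert.1 hC with rfl | hC
    · simp
    · rw [mem_singleton.1 hC, card_erase_of_mem hi]
      left; omega
  have hmem : ∀ i ∈ J, ({{m, i}, J.erase i} : Finset (Finset ℕ)) ∪ Q
      ∈ smallBlocks s (q + 1) := by
    intro i hi
    simp only [smallBlocks, mem_filter, mem_setParts]
    refine ⟨?_, ?_⟩
    · have := (hpart i hi).union hQ disjoint_sdiff
      rwa [union_sdiff_of_subset hBs] at this
    · intro C hC
      rcases mem_union.1 hC with h | h
      · rcases mem_insert.1 h with rfl | h
        · exact card_le_two.trans (by omega)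
        · rw [mem_singleton.1 h, card_erase_of_mem hi]; omega
      · exact (hQc C h).trans (Nat.le_succ q)
  obtain ⟨i, hi, j, hj, hij⟩ := one_lt_card.1 (show 1 < J.card by omega)
  have heq := hsep B hBs hmB _ _ Q (hpart i hi) (hpart j hj) (hchunk i hi) (hchunk j hj)
    (by simpa only [smallBlocks, mem_filter, mem_setParts] using ⟨hQ, hQc⟩) (hmem i hi) (hmem j hj)
  have hmi : ({m, i} : Finset ℕ) ∈ ({{m, j}, J.erase j} : Finset (Finset ℕ)) := by
    rw [← heq]; simp
  rcases mem_insert.1 hmi with h | h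
  · have : i ∈ ({m, j} : Finset ℕ) := by rw [← h]; simp
    rcases mem_insert.1 this with rfl | h'
    · exact hmJ hi
    · exact hij (mem_singleton.1 h')
  · have : m ∈ J.erase j := by rw [← mem_singleton.1 h]; simp
    exact hmJ (mem_of_mem_erase this)

/-- `i` and `j` lie in a common block of the family `P`. -/
def InSameBlock (P : Finset (Finset ℕ)) (i j : ℕ) : Prop := ∃ B ∈ P, i ∈ B ∧ j ∈ B

/-- `P` contains a copy of the partition of `[k]` whose only nonsingleton block is `{a, b}`. -/
def HasDoubletonCopy (k a b : ℕ) (P : Finset (Finset ℕ)) : Prop :=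
  ∃ f : ℕ → ℕ, StrictMonoOn f (Idx k) ∧ (∀ i ∈ Idx k, ∃ B ∈ P, f i ∈ B) ∧
    ∀ i ∈ Idx k, ∀ j ∈ Idx k, i < j → (InSameBlock P (f i) (f j) ↔ i = a ∧ j = b)

lemma mem_Idx {n i : ℕ} : i ∈ Idx n ↔ 1 ≤ i ∧ i ≤ n := by simp [Idx]

/-- Set partitions of `s` without a copy of the one-doubleton pattern. -/
def doubletonAvoiders (k a b : ℕ) (s : Finset ℕ) : Finset (Finset (Finset ℕ)) :=
  (setParts s).filter fun P => ¬ HasDoubletonCopy k a b P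

/-- Set partitions of `s` that avoid the one-doubleton pattern once the block of `m` is
removed. -/
def erasedAvoiders (m k a b : ℕ) (s : Finset ℕ) : Finset (Finset (Finset ℕ)) :=
  (setParts s).filter fun P => ∀ B ∈ P, m ∈ B → ¬ HasDoubletonCopy k a b (P.erase B)

lemma card_erasedAvoiders_le {m k a b q : ℕ} {s : Finset ℕ} (hm : m ∈ s)
    (h : ∀ t, (doubletonAvoiders k a b t).card ≤ (fewBlocks t q).card) :
    (erasedAvoiders m k a b s).card ≤ (fewBlocks s (q + 1)).card := by
  rw [erasedAvoiders, card_filter_setParts hm, card_fewBlocks_succ hm]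
  refine sum_le_sum fun B hB => le_trans (card_le_card fun Q hQ => ?_) (h (s \ B))
  simp only [doubletonAvoiders, mem_filter] at hQ hB ⊢
  refine ⟨hQ.1, ?_⟩
  have := hQ.2 B (mem_insert_self _ _) hB.2
  rwa [erase_insert ((mem_setParts.1 hQ.1).notMem ⟨m, hB.2⟩)] at this

lemma inSameBlock_erase {s B : Finset ℕ} {P : Finset (Finset ℕ)} (hP : IsPartitionOf s P)
    {x y : ℕ} (hx : ∃ C ∈ P.erase B, x ∈ C) :
    InSameBlock P x y ↔ InSameBlock (P.erase B) x y := by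
  constructor
  · rintro ⟨D, hD, hxD, hyD⟩
    obtain ⟨C, hC, hxC⟩ := hx
    have := hP.disj D hD C (mem_of_mem_erase hC) x hxD hxC
    exact ⟨D, this ▸ hC, hxD, hyD⟩
  · rintro ⟨D, hD, h⟩
    exact ⟨D, mem_of_mem_erase hD, h⟩

lemma not_inSameBlock_of_mem {s B : Finset ℕ} {P : Finset (Finset ℕ)} (hP : IsPartitionOf s P)
    {x y : ℕ} (hB : B ∈ P) (hy : y ∈ B) (hx : ∃ C ∈ P.erase B, x ∈ C) :
    ¬ InSameBlock P x y := by
  rintro ⟨D, hD, hxD, hyD⟩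
  obtain ⟨C, hC, hxC⟩ := hx
  have h1 := hP.disj D hD C (mem_of_mem_erase hC) x hxD hxC
  have h2 := hP.disj D hD B hB y hyD hy
  exact (mem_erase.1 hC).1 (h1.symm.trans h2)

lemma inSameBlock_comm {P : Finset (Finset ℕ)} {x y : ℕ} :
    InSameBlock P x y ↔ InSameBlock P y x := by
  simp only [InSameBlock, and_comm]

/-- A least element in a removed block can play the role of an initial singleton. -/
lemma HasDoubletonCopy.of_erase_min {s B : Finset ℕ} {P : Finset (Finset ℕ)} {m k a b : ℕ}
    (hP : IsPartitionOf s P) (hmin : ∀ x ∈ s, m ≤ x) (hB : B ∈ P) (hmB : m ∈ B) (ha : 1 ≤ a)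
    (h : HasDoubletonCopy k a b (P.erase B)) : HasDoubletonCopy (k + 1) (a + 1) (b + 1) P := by
  obtain ⟨f, hf, hfc, hfs⟩ := h
  have hlt : ∀ i ∈ Idx k, m < f i := by
    intro i hi
    obtain ⟨C, hC, hfC⟩ := hfc i hi
    refine lt_of_le_of_ne (hmin _ (hP.sub C (mem_of_mem_erase hC) hfC)) ?_
    rintro rfl
    exact (mem_erase.1 hC).1 (hP.disj C (mem_of_mem_erase hC) B hB _ hfC hmB)
  have hpred : ∀ i ∈ Idx (k + 1), i ≠ 1 → i - 1 ∈ Idx k := by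
    intro i hi hi1; rw [mem_Idx] at *; omega
  refine ⟨fun i => if i = 1 then m else f (i - 1), ?_, ?_, ?_⟩
  · intro i hi j hj hij
    rw [mem_coe] at hi hj
    have hj1 : j ≠ 1 := by rw [mem_Idx] at hi; omega
    simp only [if_neg hj1]
    split_ifs with hi1
    · exact hlt _ (hpred j hj hj1)
    · refine hf (hpred i hi hi1) (hpred j hj hj1) ?_
      rw [mem_Idx] at hi; omega
  · intro i hi
    dsimp only
    split_ifs with hi1
    · exact ⟨B, hB, hmB⟩
    · obtain ⟨C, hC, h⟩ := hfc _ (hpred i hi hi1)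
      exact ⟨C, mem_of_mem_erase hC, h⟩
  · intro i hi j hj hij
    have hj1 : j ≠ 1 := by rw [mem_Idx] at hi; omega
    simp only [if_neg hj1]
    split_ifs with hi1
    · rw [inSameBlock_comm]
      refine iff_of_false (not_inSameBlock_of_mem hP hB hmB (hfc _ (hpred j hj hj1))) ?_
      omega
    · rw [inSameBlock_erase hP (hfc _ (hpred i hi hi1)),
        hfs _ (hpred i hi hi1) _ (hpred j hj hj1) (by rw [mem_Idx] at hi; omega)]
      rw [mem_Idx] at hi
      omega

/-- A greatest element in a removed block can play the role of a final singleton. -/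
lemma HasDoubletonCopy.of_erase_max {s B : Finset ℕ} {P : Finset (Finset ℕ)} {m k a b : ℕ}
    (hP : IsPartitionOf s P) (hmax : ∀ x ∈ s, x ≤ m) (hB : B ∈ P) (hmB : m ∈ B) (hb : b ≤ k)
    (h : HasDoubletonCopy k a b (P.erase B)) : HasDoubletonCopy (k + 1) a b P := by
  obtain ⟨f, hf, hfc, hfs⟩ := h
  have hlt : ∀ i ∈ Idx k, f i < m := by
    intro i hi
    obtain ⟨C, hC, hfC⟩ := hfc i hi
    refine lt_of_le_of_ne (hmax _ (hP.sub C (mem_of_mem_erase hC) hfC)) ?_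
    rintro rfl
    exact (mem_erase.1 hC).1 (hP.disj C (mem_of_mem_erase hC) B hB _ hfC hmB)
  have hpred : ∀ i ∈ Idx (k + 1), i ≠ k + 1 → i ∈ Idx k := by
    intro i hi hi1; rw [mem_Idx] at *; omega
  refine ⟨fun i => if i = k + 1 then m else f i, ?_, ?_, ?_⟩
  · intro i hi j hj hij
    rw [mem_coe] at hi hj
    have hi1 : i ≠ k + 1 := by rw [mem_Idx] at hj; omega
    simp only [if_neg hi1]
    split_ifs with hj1
    · exact hlt _ (hpred i hi hi1)
    · exact hf (hpred i hi hi1) (hpred j hj hj1) hij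
  · intro i hi
    dsimp only
    split_ifs with hi1
    · exact ⟨B, hB, hmB⟩
    · obtain ⟨C, hC, h⟩ := hfc _ (hpred i hi hi1)
      exact ⟨C, mem_of_mem_erase hC, h⟩
  · intro i hi j hj hij
    have hi1 : i ≠ k + 1 := by rw [mem_Idx] at hj; omega
    simp only [if_neg hi1]
    split_ifs with hj1
    · refine iff_of_false (not_inSameBlock_of_mem hP hB hmB (hfc _ (hpred i hi hi1))) ?_
      omega
    · rw [inSameBlock_erase hP (hfc _ (hpred i hi hi1)),
        hfs _ (hpred i hi hi1) _ (hpred j hj hj1) hij]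

lemma exists_enumeration (K : Finset ℕ) {k : ℕ} (hK : K.card = k) :
    ∃ f : ℕ → ℕ, StrictMonoOn f (Idx k) ∧ (∀ i ∈ Idx k, f i ∈ K) ∧
      ∀ x ∈ K, ∃ i ∈ Idx k, f i = x := by
  subst hK
  refine ⟨fun i => if h : i - 1 < K.card then K.orderEmbOfFin rfl ⟨i - 1, h⟩ else 0, ?_, ?_, ?_⟩
  · intro i hi j hj hij
    rw [mem_coe, mem_Idx] at hi hj
    have h1 : i - 1 < K.card := by omega
    have h2 : j - 1 < K.card := by omega
    simp only [dif_pos h1, dif_pos h2]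
    refine (K.orderEmbOfFin rfl).strictMono ?_
    rw [Fin.mk_lt_mk]
    omega
  · intro i hi
    rw [mem_Idx] at hi
    have h1 : i - 1 < K.card := by omega
    simp only [dif_pos h1]
    exact orderEmbOfFin_mem _ _ _
  · intro x hx
    have : x ∈ Set.range (K.orderEmbOfFin rfl) := by rwa [range_orderEmbOfFin]
    obtain ⟨⟨i, hi⟩, rfl⟩ := this
    exact ⟨i + 1, mem_Idx.2 (by omega), by simp [hi]⟩

/-- Two elements of one block with `r` further blocks meeting the gap between them form a copy
of the pattern whose doubleton is `{1, r + 2}`. -/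
lemma HasDoubletonCopy.of_gap {s : Finset ℕ} {P 𝒞 : Finset (Finset ℕ)} {r x y : ℕ}
    (hP : IsPartitionOf s P) (hxy : x < y) (hs : InSameBlock P x y) (h𝒞 : 𝒞 ⊆ P)
    (hcard : r ≤ 𝒞.card) (hx : ∀ C ∈ 𝒞, x ∉ C) (hgap : ∀ C ∈ 𝒞, ∃ z ∈ C, x < z ∧ z < y) :
    HasDoubletonCopy (r + 2) 1 (r + 2) P := by
  obtain ⟨𝒟, h𝒟, h𝒟c⟩ := exists_subset_card_eq hcard
  choose! g hg using hgap
  obtain ⟨X, hX, hxX, hyX⟩ := hs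
  have hginj : ∀ C ∈ 𝒟, ∀ D ∈ 𝒟, ∀ Y ∈ P, g C ∈ Y → g D ∈ Y → C = D := by
    intro C hC D hD Y hY h1 h2
    rw [hP.disj C (h𝒞 (h𝒟 hC)) Y hY _ (hg C (h𝒟 hC)).1 h1,
      hP.disj D (h𝒞 (h𝒟 hD)) Y hY _ (hg D (h𝒟 hD)).1 h2]
  have hgX : ∀ C ∈ 𝒟, g C ∉ X := by
    intro C hC h
    have := hP.disj C (h𝒞 (h𝒟 hC)) X hX _ (hg C (h𝒟 hC)).1 h
    exact hx C (h𝒟 hC) (this ▸ hxX)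
  set K := insert x (insert y (𝒟.image g)) with hK
  have hKc : K.card = r + 2 := by
    rw [hK, card_insert_of_notMem, card_insert_of_notMem, card_image_of_injOn, h𝒟c]
    · intro C hC D hD h
      exact hginj C hC D hD C (h𝒞 (h𝒟 hC)) (hg C (h𝒟 hC)).1 (h ▸ (hg C (h𝒟 hC)).1)
    · intro h
      obtain ⟨C, hC, h⟩ := mem_image.1 h
      have := (hg C (h𝒟 hC)).2; omega
    · intro h
      rcases mem_insert.1 h with h | h
      · omega
      · obtain ⟨C, hC, h⟩ := mem_image.1 h
        have := (hg C (h𝒟 hC)).2; omega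
  obtain ⟨f, hf, hfK, hfs⟩ := exists_enumeration K hKc
  have hKmem : ∀ z ∈ K, z = x ∨ z = y ∨ ∃ C ∈ 𝒟, g C = z := by
    intro z hz; simpa [hK] using hz
  have hKb : ∀ z ∈ K, x ≤ z ∧ z ≤ y := by
    intro z hz
    rcases hKmem z hz with rfl | rfl | ⟨C, hC, rfl⟩
    · omega
    · omega
    · have := (hg C (h𝒟 hC)).2; omega
  have h1 : (1 : ℕ) ∈ Idx (r + 2) := mem_Idx.2 (by omega)
  have h2 : r + 2 ∈ Idx (r + 2) := mem_Idx.2 (by omega)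
  have hf1 : f 1 = x := by
    obtain ⟨i, hi, h⟩ := hfs x (by simp [hK])
    refine le_antisymm ?_ (hKb _ (hfK 1 h1)).1
    rw [← h]
    exact hf.monotoneOn h1 hi (mem_Idx.1 hi).1
  have hf2 : f (r + 2) = y := by
    obtain ⟨i, hi, h⟩ := hfs y (by simp [hK])
    refine le_antisymm (hKb _ (hfK _ h2)).2 ?_
    rw [← h]
    exact hf.monotoneOn hi h2 (mem_Idx.1 hi).2
  refine ⟨f, hf, ?_, ?_⟩
  · intro i hi
    rcases hKmem _ (hfK i hi) with h | h | ⟨C, hC, h⟩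
    · exact ⟨X, hX, h ▸ hxX⟩
    · exact ⟨X, hX, h ▸ hyX⟩
    · exact ⟨C, h𝒞 (h𝒟 hC), h ▸ (hg C (h𝒟 hC)).1⟩
  · intro i hi j hj hij
    have hfij := hf hi hj hij
    constructor
    · rintro ⟨Y, hY, hiY, hjY⟩
      have hXY : ∀ z ∈ Y, z ∈ X → Y = X := fun z hz hz' => hP.disj Y hY X hX z hz hz'
      rcases hKmem _ (hfK i hi) with h | h | ⟨C, hC, h⟩ <;>
        rcases hKmem _ (hfK j hj) with h' | h' | ⟨D, hD, h'⟩
      · omega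
      · exact ⟨hf.injOn hi h1 (h.trans hf1.symm), hf.injOn hj h2 (h'.trans hf2.symm)⟩
      · refine absurd ?_ (hgX D hD)
        rw [h', ← hXY _ hiY (h ▸ hxX)]; exact hjY
      · omega
      · omega
      · have := (hKb _ (hfK j hj)).2; omega
      · have := (hKb _ (hfK i hi)).1; omega
      · refine absurd ?_ (hgX C hC)
        rw [h, ← hXY _ hjY (h' ▸ hyX)]; exact hiY
      · have := hginj C hC D hD Y hY (h ▸ hiY) (h' ▸ hjY)
        subst this; omega
    · rintro ⟨rfl, rfl⟩
      exact ⟨X, hX, hf1 ▸ hxX, hf2 ▸ hyX⟩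

/-- Put the new element `m` into the block `B` of `P`. -/
def joinBlock (m : ℕ) (P : Finset (Finset ℕ)) (B : Finset ℕ) : Finset (Finset ℕ) :=
  insert (insert m B) (P.erase B)

section Extension

variable {s B : Finset ℕ} {P : Finset (Finset ℕ)} {m : ℕ}

lemma IsPartitionOf.insert_singleton (hP : IsPartitionOf (s.erase m) P) (hm : m ∈ s) :
    IsPartitionOf s (insert {m} P) := by
  rw [erase_eq] at hP
  exact hP.insertBlock (singleton_subset_iff.2 hm) (singleton_nonempty m)

lemma IsPartitionOf.notMem_of_erase (hP : IsPartitionOf (s.erase m) P) (hB : B ∈ P) : m ∉ B :=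
  fun h => by simpa using hP.sub B hB h

lemma IsPartitionOf.singleton_notMem (hP : IsPartitionOf (s.erase m) P) : {m} ∉ P :=
  fun h => hP.notMem_of_erase h (mem_singleton_self m)

lemma IsPartitionOf.insert_notMem_erase (hP : IsPartitionOf (s.erase m) P) :
    insert m B ∉ P.erase B :=
  fun h => hP.notMem_of_erase (mem_of_mem_erase h) (mem_insert_self m B)

lemma IsPartitionOf.joinBlock (hP : IsPartitionOf (s.erase m) P) (hm : m ∈ s) (hB : B ∈ P) :
    IsPartitionOf s (joinBlock m P B) := by
  have h := hP.eraseBlock hB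
  have heq : s.erase m \ B = s \ insert m B := by
    ext x; simp only [mem_sdiff, mem_erase, mem_insert]; tauto
  rw [heq] at h
  exact h.insertBlock (insert_subset hm ((hP.sub B hB).trans (erase_subset _ _)))
    (insert_nonempty _ _)

lemma IsPartitionOf.card_joinBlock (hP : IsPartitionOf (s.erase m) P) (hB : B ∈ P) :
    (_root_.joinBlock m P B).card = P.card := by
  rw [_root_.joinBlock, card_insert_of_notMem hP.insert_notMem_erase, card_erase_add_one hB]

/-- Every set partition of `s` arises from one of `s.erase m` by adding `m`. -/
lemma IsPartitionOf.exists_extension (hP : IsPartitionOf s P) (hm : m ∈ s) :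
    ∃ P', IsPartitionOf (s.erase m) P' ∧
      (P = insert {m} P' ∨ ∃ B ∈ P', P = _root_.joinBlock m P' B) := by
  obtain ⟨C, hC, hmC⟩ := hP.cover m hm
  have hPC := hP.eraseBlock hC
  by_cases h : C = {m}
  · subst h
    rw [← erase_eq] at hPC
    exact ⟨_, hPC, Or.inl (insert_erase hC).symm⟩
  · have hne : (C.erase m).Nonempty := by
      rw [nonempty_iff_ne_empty]
      intro h0
      rcases (erase_eq_empty_iff C m).1 h0 with h1 | h1
      · simp [h1] at hmC
      · exact h h1
    have heq : s \ C = s.erase m \ C.erase m := by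
      ext x; simp only [mem_sdiff, mem_erase]
      constructor
      · rintro ⟨h1, h2⟩
        exact ⟨⟨by rintro rfl; exact h2 hmC, h1⟩, fun h => h2 h.2⟩
      · rintro ⟨⟨h1, h2⟩, h3⟩
        exact ⟨h2, fun h => h3 ⟨h1, h⟩⟩
    rw [heq] at hPC
    refine ⟨insert (C.erase m) (P.erase C),
      hPC.insertBlock (erase_subset_erase _ (hP.sub C hC)) hne, Or.inr ⟨_, mem_insert_self _ _, ?_⟩⟩
    rw [_root_.joinBlock, erase_insert (hPC.notMem hne), insert_erase hmC, insert_erase hC]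

lemma HasDoubletonCopy.mono {P' : Finset (Finset ℕ)} {k a b : ℕ}
    (hcov : ∀ B ∈ P, ∀ x ∈ B, ∃ C ∈ P', x ∈ C)
    (hs : ∀ x y, (∃ B ∈ P, x ∈ B) → (∃ B ∈ P, y ∈ B) →
      (InSameBlock P' x y ↔ InSameBlock P x y))
    (h : HasDoubletonCopy k a b P) : HasDoubletonCopy k a b P' := by
  obtain ⟨f, hf, hfc, hfs⟩ := h
  refine ⟨f, hf, ?_, ?_⟩
  · intro i hi
    obtain ⟨B, hB, h⟩ := hfc i hi
    exact hcov B hB _ h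
  · intro i hi j hj hij
    rw [hs _ _ (hfc i hi) (hfc j hj), hfs i hi j hj hij]

lemma HasDoubletonCopy.insert_singleton {k a b : ℕ} (hP : IsPartitionOf (s.erase m) P)
    (h : HasDoubletonCopy k a b P) : HasDoubletonCopy k a b (insert {m} P) := by
  refine h.mono (fun B hB x hx => ⟨B, mem_insert_of_mem hB, hx⟩) ?_
  rintro x y ⟨B, hB, hx⟩ -
  constructor
  · rintro ⟨C, hC, hxC, hyC⟩
    rcases mem_insert.1 hC with rfl | hC
    · rw [mem_singleton.1 hxC] at hx
      exact absurd hx (hP.notMem_of_erase hB)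
    · exact ⟨C, hC, hxC, hyC⟩
  · rintro ⟨C, hC, h⟩
    exact ⟨C, mem_insert_of_mem hC, h⟩

lemma HasDoubletonCopy.joinBlock {k a b : ℕ} (hP : IsPartitionOf (s.erase m) P) (hB : B ∈ P)
    (h : HasDoubletonCopy k a b P) : HasDoubletonCopy k a b (joinBlock m P B) := by
  have hup : ∀ C ∈ P, ∃ D ∈ _root_.joinBlock m P B, C ⊆ D := by
    intro C hC
    by_cases hCB : C = B
    · exact ⟨insert m B, mem_insert_self _ _, hCB ▸ subset_insert _ _⟩
    · exact ⟨C, mem_insert_of_mem (mem_erase.2 ⟨hCB, hC⟩), Subset.rfl⟩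
  refine h.mono (fun C hC x hx => ?_) ?_
  · obtain ⟨D, hD, h⟩ := hup C hC
    exact ⟨D, hD, h hx⟩
  · rintro x y ⟨X, hX, hxX⟩ ⟨Y, hY, hyY⟩
    have hxm : x ≠ m := by rintro rfl; exact hP.notMem_of_erase hX hxX
    have hym : y ≠ m := by rintro rfl; exact hP.notMem_of_erase hY hyY
    constructor
    · rintro ⟨C, hC, hxC, hyC⟩
      rcases mem_insert.1 hC with rfl | hC
      · exact ⟨B, hB, mem_of_mem_insert_of_ne hxC hxm, mem_of_mem_insert_of_ne hyC hym⟩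
      · exact ⟨C, mem_of_mem_erase hC, hxC, hyC⟩
    · rintro ⟨C, hC, hxC, hyC⟩
      obtain ⟨D, hD, h⟩ := hup C hC
      exact ⟨D, hD, h hxC, h hyC⟩

end Extension

/-- Set partitions of `s` with exactly `q` blocks. -/
def exactBlocks (s : Finset ℕ) (q : ℕ) : Finset (Finset (Finset ℕ)) :=
  (setParts s).filter fun P => P.card = q

lemma le_card_exactBlocks {s : Finset ℕ} {m : ℕ} (hm : m ∈ s) (r : ℕ) :
    (r + 1) * (exactBlocks (s.erase m) (r + 1)).card + (exactBlocks (s.erase m) r).card ≤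
      (exactBlocks s (r + 1)).card := by
  set J := ((exactBlocks (s.erase m) (r + 1)).sigma fun P => P).image
    (fun a => joinBlock m a.1 a.2) with hJ
  set N := (exactBlocks (s.erase m) r).image (fun P => insert {m} P) with hN
  have hJc : J.card = (r + 1) * (exactBlocks (s.erase m) (r + 1)).card := by
    rw [hJ, card_image_of_injOn, card_sigma, mul_comm,
      sum_const_nat (s := exactBlocks (s.erase m) (r + 1)) fun P hP => (mem_filter.1 hP).2]
    rintro ⟨P, B⟩ h ⟨P', B'⟩ h' heq
    simp only [coe_sigma, Set.mem_sigma_iff, mem_coe, exactBlocks, mem_filter,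
      mem_setParts] at h h' heq
    obtain ⟨⟨hP, -⟩, hB⟩ := h
    obtain ⟨⟨hP', -⟩, hB'⟩ := h'
    have hBB : insert m B = insert m B' :=
      (hP.joinBlock hm hB).disj _ (mem_insert_self _ _) _ (heq ▸ mem_insert_self _ _) m
        (mem_insert_self _ _) (mem_insert_self _ _)
    have hB0 : B = B' := by
      rw [← erase_insert (hP.notMem_of_erase hB), hBB, erase_insert (hP'.notMem_of_erase hB')]
    subst hB0
    have : P.erase B = P'.erase B := by
      rw [← erase_insert (hP.insert_notMem_erase (B := B)),
        ← erase_insert (hP'.insert_notMem_erase (B := B))]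
      exact congrArg (fun R => R.erase (insert m B)) heq
    rw [← insert_erase hB, this, insert_erase hB']
  have hNc : N.card = (exactBlocks (s.erase m) r).card := by
    rw [hN, card_image_of_injOn]
    intro P h P' h' heq
    simp only [mem_coe, exactBlocks, mem_filter, mem_setParts] at h h' heq
    rw [← erase_insert h.1.singleton_notMem, heq, erase_insert h'.1.singleton_notMem]
  have hd : Disjoint J N := by
    rw [Finset.disjoint_left]
    intro R hRJ hRN
    simp only [hJ, hN, mem_image, mem_sigma, exactBlocks, mem_filter, mem_setParts] at hRJ hRN
    obtain ⟨⟨P, B⟩, ⟨⟨hP, -⟩, hB⟩, rfl⟩ := hRJ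
    obtain ⟨P', ⟨hP', -⟩, heq⟩ := hRN
    dsimp only at *
    have hmem : {m} ∈ joinBlock m P B := heq ▸ mem_insert_self _ _
    have h1 := (hP.joinBlock hm hB).disj _ hmem _ (mem_insert_self _ _) m
      (mem_singleton_self m) (mem_insert_self _ _)
    obtain ⟨x, hx⟩ := hP.nonempty B hB
    have h2 : x ∈ ({m} : Finset ℕ) := h1 ▸ mem_insert_of_mem hx
    rw [mem_singleton.1 h2] at hx
    exact hP.notMem_of_erase hB hx
  rw [← hJc, ← hNc, ← card_union_of_disjoint hd]
  refine card_le_card (union_subset ?_ ?_) <;> intro R hR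
  · simp only [hJ, mem_image, mem_sigma, exactBlocks, mem_filter, mem_setParts] at hR ⊢
    obtain ⟨⟨P, B⟩, ⟨⟨hP, hc⟩, hB⟩, rfl⟩ := hR
    exact ⟨hP.joinBlock hm hB, (hP.card_joinBlock hB).trans hc⟩
  · simp only [hN, mem_image, exactBlocks, mem_filter, mem_setParts] at hR ⊢
    obtain ⟨P, ⟨hP, hc⟩, rfl⟩ := hR
    exact ⟨hP.insert_singleton hm, by rw [card_insert_of_notMem hP.singleton_notMem, hc]⟩

/-- Set partitions of `s` with at least `r + 1` blocks avoiding the pattern of `[r + 2]` whose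
doubleton is `{1, r + 2}`. -/
def gapAvoiders (r : ℕ) (s : Finset ℕ) : Finset (Finset (Finset ℕ)) :=
  (setParts s).filter fun P => r + 1 ≤ P.card ∧ ¬ HasDoubletonCopy (r + 2) 1 (r + 2) P

/-- The blocks of `P` that the new element `m` may join without creating the pattern of
`[r + 2]` whose doubleton is `{1, r + 2}`. -/
def allowedJoins (r m : ℕ) (P : Finset (Finset ℕ)) : Finset (Finset ℕ) :=
  P.filter fun B => ¬ HasDoubletonCopy (r + 2) 1 (r + 2) (joinBlock m P B)

lemma card_gapAvoiders_le_sum {s : Finset ℕ} {m : ℕ} (hm : m ∈ s) (r : ℕ) :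
    (gapAvoiders r s).card ≤ (exactBlocks (s.erase m) r).card +
      ∑ P ∈ gapAvoiders r (s.erase m), ((allowedJoins r m P).card + 1) := by
  have hsub : gapAvoiders r s ⊆
      (exactBlocks (s.erase m) r).image (fun P => insert {m} P) ∪
      (gapAvoiders r (s.erase m)).biUnion fun P =>
        insert (insert {m} P) ((allowedJoins r m P).image fun B => joinBlock m P B) := by
    intro R hR
    simp only [gapAvoiders, mem_filter, mem_setParts] at hR
    obtain ⟨hR, hc, hav⟩ := hR
    simp only [mem_union, mem_image, mem_biUnion, mem_insert, exactBlocks, gapAvoiders,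
      allowedJoins, mem_filter, mem_setParts]
    obtain ⟨P, hP, rfl | ⟨B, hB, rfl⟩⟩ := hR.exists_extension hm
    · rw [card_insert_of_notMem hP.singleton_notMem] at hc
      by_cases h : P.card = r
      · exact Or.inl ⟨P, ⟨hP, h⟩, rfl⟩
      · exact Or.inr ⟨P, ⟨hP, by omega, fun h => hav (h.insert_singleton hP)⟩, Or.inl rfl⟩
    · rw [hP.card_joinBlock hB] at hc
      exact Or.inr ⟨P, ⟨hP, hc, fun h => hav (h.joinBlock hP hB)⟩, Or.inr ⟨B, ⟨hB, hav⟩, rfl⟩⟩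
  refine (card_le_card hsub).trans ((card_union_le _ _).trans (add_le_add card_image_le ?_))
  refine card_biUnion_le.trans (sum_le_sum fun P _ => ?_)
  exact (card_insert_le _ _).trans (Nat.succ_le_succ card_image_le)

/-- In a set with an injective height function, at most `r` elements have fewer than `r`
elements above them. -/
lemma card_le_of_card_above_lt {α : Type*} {Z W : Finset α} {g : α → ℕ} {r : ℕ}
    (hZW : Z ⊆ W) (hg : Set.InjOn g W)
    (h : ∀ z ∈ Z, (W.filter fun w => g z < g w).card < r) : Z.card ≤ r := by
  rcases Z.eq_empty_or_nonempty with rfl | hZ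
  · simp
  obtain ⟨z, hz, hmin⟩ := exists_min_image Z g hZ
  have hsub : Z.erase z ⊆ W.filter fun w => g z < g w := by
    intro w hw
    rw [mem_erase] at hw
    refine mem_filter.2 ⟨hZW hw.2, lt_of_le_of_ne (hmin w hw.2) fun heq => hw.1 ?_⟩
    exact hg (hZW hw.2) (hZW hz) heq.symm
  have := card_le_card hsub
  rw [card_erase_of_mem hz] at this
  have := h z hz
  omega

/-- Joining the greatest element to a block that is followed by elements of `r` other blocks
creates a copy of the pattern whose doubleton is `{1, r + 2}`. -/
lemma HasDoubletonCopy.of_joinBlock {s B : Finset ℕ} {P 𝒞 : Finset (Finset ℕ)} {r m x : ℕ}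
    (hP : IsPartitionOf (s.erase m) P) (hm : m ∈ s) (hmax : ∀ y ∈ s, y ≤ m) (hB : B ∈ P)
    (hx : x ∈ B) (h𝒞 : 𝒞 ⊆ P.erase B) (hcard : r ≤ 𝒞.card) (hgap : ∀ C ∈ 𝒞, ∃ z ∈ C, x < z) :
    HasDoubletonCopy (r + 2) 1 (r + 2) (_root_.joinBlock m P B) := by
  have hlt : ∀ C ∈ P, ∀ z ∈ C, z < m := fun C hC z hz =>
    lt_of_le_of_ne (hmax z (mem_of_mem_erase (hP.sub C hC hz)))
      fun h => hP.notMem_of_erase hC (h ▸ hz)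
  refine HasDoubletonCopy.of_gap (hP.joinBlock hm hB) (hlt B hB x hx)
    ⟨insert m B, mem_insert_self _ _, mem_insert_of_mem hx, mem_insert_self _ _⟩
    (h𝒞.trans (subset_insert _ _)) hcard ?_ ?_
  · intro C hC hxC
    have := mem_erase.1 (h𝒞 hC)
    exact this.1 (hP.disj C this.2 B hB x hxC hx)
  · intro C hC
    obtain ⟨z, hz, hxz⟩ := hgap C hC
    exact ⟨z, hz, hxz, hlt C (mem_of_mem_erase (h𝒞 hC)) z hz⟩

lemma card_allowedJoins_le {s : Finset ℕ} {P : Finset (Finset ℕ)} {r m : ℕ}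
    (hP : IsPartitionOf (s.erase m) P) (hm : m ∈ s) (hmax : ∀ y ∈ s, y ≤ m) :
    (allowedJoins r m P).card ≤ r := by
  have hsup : ∀ B ∈ P, B.sup id ∈ B := by
    intro B hB
    obtain ⟨x, hx, h⟩ := exists_mem_eq_sup B (hP.nonempty B hB) id
    rw [h]; exact hx
  refine card_le_of_card_above_lt (W := P) (g := fun B => B.sup id) (filter_subset _ _) ?_ ?_
  · intro B hB C hC h
    dsimp only at h
    exact hP.disj B hB C hC _ (hsup B hB) (h ▸ hsup C hC)
  · intro B hB
    obtain ⟨hBP, hav⟩ := mem_filter.1 hB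
    by_contra! hcard
    refine hav (HasDoubletonCopy.of_joinBlock hP hm hmax hBP (hsup B hBP) ?_ hcard ?_)
    · intro C hC
      rw [mem_filter] at hC
      exact mem_erase.2 ⟨fun h => by simp [h] at hC, hC.1⟩
    · intro C hC
      rw [mem_filter] at hC
      exact ⟨_, hsup C hC.1, hC.2⟩

lemma card_gapAvoiders_le (r : ℕ) (s : Finset ℕ) :
    (gapAvoiders r s).card ≤ (exactBlocks s (r + 1)).card := by
  induction s using Finset.strongInduction with
  | H s ih =>
    rcases s.eq_empty_or_nonempty with rfl | hs
    · simp [gapAvoiders, setParts_empty, filter_singleton]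
    · obtain ⟨m, hm, hmax⟩ := exists_max_image s id hs
      refine (card_gapAvoiders_le_sum hm r).trans (le_trans ?_ (le_card_exactBlocks hm r))
      have h1 : ∑ P ∈ gapAvoiders r (s.erase m), ((allowedJoins r m P).card + 1) ≤
          (gapAvoiders r (s.erase m)).card * (r + 1) := by
        rw [← smul_eq_mul]
        refine sum_le_card_nsmul _ _ _ fun P hP => ?_
        have := card_allowedJoins_le (r := r) (mem_setParts.1 (mem_filter.1 hP).1) hm hmax
        omega
      have h2 := Nat.mul_le_mul_right (r + 1) (ih _ (erase_ssubset hm))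
      rw [mul_comm (r + 1)]
      omega

lemma card_gapAvoiders_lt {s : Finset ℕ} {P : Finset (Finset ℕ)} {r m : ℕ} (hm : m ∈ s)
    (hmax : ∀ y ∈ s, y ≤ m) (hP : P ∈ gapAvoiders r (s.erase m))
    (hlt : (allowedJoins r m P).card < r) :
    (gapAvoiders r s).card < (exactBlocks s (r + 1)).card := by
  refine (card_gapAvoiders_le_sum hm r).trans_lt (lt_of_lt_of_le ?_ (le_card_exactBlocks hm r))
  have h1 : ∑ P ∈ gapAvoiders r (s.erase m), ((allowedJoins r m P).card + 1) <
      ∑ _P ∈ gapAvoiders r (s.erase m), (r + 1) := by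
    refine sum_lt_sum (fun P hP => ?_) ⟨P, hP, by omega⟩
    have := card_allowedJoins_le (r := r) (mem_setParts.1 (mem_filter.1 hP).1) hm hmax
    omega
  rw [sum_const, smul_eq_mul] at h1
  have h2 := Nat.mul_le_mul_right (r + 1) (card_gapAvoiders_le r (s.erase m))
  rw [mul_comm (r + 1)]
  omega

lemma card_doubletonAvoiders_gap_le_add (r : ℕ) (s : Finset ℕ) :
    (doubletonAvoiders (r + 2) 1 (r + 2) s).card ≤
      (fewBlocks s r).card + (gapAvoiders r s).card := by
  refine (card_le_card fun P hP => ?_).trans (card_union_le _ _)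
  simp only [doubletonAvoiders, fewBlocks, gapAvoiders, mem_union, mem_filter] at hP ⊢
  by_cases h : P.card ≤ r
  · exact Or.inl ⟨hP.1, h⟩
  · exact Or.inr ⟨hP.1, by omega, hP.2⟩

lemma card_fewBlocks_add_exactBlocks (r : ℕ) (s : Finset ℕ) :
    (fewBlocks s r).card + (exactBlocks s (r + 1)).card = (fewBlocks s (r + 1)).card := by
  rw [fewBlocks, exactBlocks, ← card_union_of_disjoint, ← filter_or, fewBlocks]
  · congr 1
    exact filter_congr fun P _ => by omega
  · exact disjoint_filter.2 fun P _ h => by omega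

lemma card_doubletonAvoiders_le {k a b : ℕ} (ha : 1 ≤ a) (hab : a < b) (hb : b ≤ k)
    (s : Finset ℕ) : (doubletonAvoiders k a b s).card ≤ (fewBlocks s (k - 1)).card := by
  induction k generalizing a b s with
  | zero => omega
  | succ k ih =>
    obtain ⟨q, rfl⟩ : ∃ q, k = q + 1 := ⟨k - 1, by omega⟩
    rcases s.eq_empty_or_nonempty with rfl | hs
    · refine card_le_card fun P hP => ?_
      simp only [doubletonAvoiders, fewBlocks, mem_filter, setParts_empty, mem_singleton] at hP ⊢
      obtain ⟨rfl, -⟩ := hP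
      exact ⟨rfl, by simp⟩
    by_cases ha1 : a = 1
    · by_cases hbk : b = q + 2
      · subst ha1 hbk
        have := card_gapAvoiders_le q s
        have := card_doubletonAvoiders_gap_le_add q s
        have := card_fewBlocks_add_exactBlocks q s
        change (doubletonAvoiders (q + 2) 1 (q + 2) s).card ≤ (fewBlocks s (q + 1)).card
        omega
      · obtain ⟨m, hm, hmax⟩ := exists_max_image s id hs
        refine (card_le_card fun P hP => ?_).trans
          (card_erasedAvoiders_le hm fun t => ih ha hab (by omega) t)
        simp only [doubletonAvoiders, erasedAvoiders, mem_filter] at hP ⊢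
        exact ⟨hP.1, fun B hB hmB h => hP.2
          (h.of_erase_max (mem_setParts.1 hP.1) hmax hB hmB (by omega))⟩
    · obtain ⟨a, rfl⟩ : ∃ a', a = a' + 1 := ⟨a - 1, by omega⟩
      obtain ⟨b, rfl⟩ : ∃ b', b = b' + 1 := ⟨b - 1, by omega⟩
      obtain ⟨m, hm, hmin⟩ := exists_min_image s id hs
      refine (card_le_card fun P hP => ?_).trans
        (card_erasedAvoiders_le hm fun t => ih (a := a) (b := b) (by omega) (by omega) (by omega) t)
      simp only [doubletonAvoiders, erasedAvoiders, mem_filter] at hP ⊢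
      exact ⟨hP.1, fun B hB hmB h => hP.2
        (h.of_erase_min (mem_setParts.1 hP.1) hmin hB hmB (by omega))⟩

/-- The set partition of `s` with block `C` and all other blocks singletons. -/
def oneBlock (C s : Finset ℕ) : Finset (Finset ℕ) := insert C ((s \ C).image fun x => {x})

lemma isPartitionOf_oneBlock {C s : Finset ℕ} (hCs : C ⊆ s) (hC : C.Nonempty) :
    IsPartitionOf s (oneBlock C s) :=
  (isPartitionOf_image_singleton _).insertBlock hCs hC

lemma oneBlock_erase {C s : Finset ℕ} (hC : C.Nonempty) :
    (oneBlock C s).erase C = (s \ C).image fun x => {x} :=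
  erase_insert ((isPartitionOf_image_singleton (s \ C)).notMem hC)

lemma card_oneBlock {C s : Finset ℕ} (hCs : C ⊆ s) (hC : C.Nonempty) :
    (oneBlock C s).card = s.card - C.card + 1 := by
  rw [oneBlock, card_insert_of_notMem ((isPartitionOf_image_singleton (s \ C)).notMem hC),
    card_image_of_injective _ singleton_injective, card_sdiff_of_subset hCs]

lemma inSameBlock_oneBlock {C s : Finset ℕ} {x y : ℕ} (hx : x ∈ s) :
    InSameBlock (oneBlock C s) x y ↔ x = y ∨ (x ∈ C ∧ y ∈ C) := by
  constructor
  · rintro ⟨B, hB, hxB, hyB⟩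
    rcases mem_insert.1 hB with rfl | hB
    · exact Or.inr ⟨hxB, hyB⟩
    · obtain ⟨z, -, rfl⟩ := mem_image.1 hB
      exact Or.inl ((mem_singleton.1 hxB).trans (mem_singleton.1 hyB).symm)
  · rintro (rfl | ⟨hxC, hyC⟩)
    · by_cases hxC : x ∈ C
      · exact ⟨C, mem_insert_self _ _, hxC, hxC⟩
      · exact ⟨{x}, mem_insert_of_mem (mem_image_of_mem _ (mem_sdiff.2 ⟨hx, hxC⟩)), by simp⟩
    · exact ⟨C, mem_insert_self _ _, hxC, hyC⟩

lemma hasDoubletonCopy_oneBlock {C s : Finset ℕ} {k a b : ℕ} {f : ℕ → ℕ} (hf : StrictMono f)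
    (hfs : ∀ i ∈ Idx k, f i ∈ s) (hfC : ∀ i ∈ Idx k, (f i ∈ C ↔ i = a ∨ i = b)) (hab : a < b) :
    HasDoubletonCopy k a b (oneBlock C s) := by
  refine ⟨f, hf.strictMonoOn _, ?_, ?_⟩
  · intro i hi
    obtain ⟨B, hB, h, -⟩ := (inSameBlock_oneBlock (C := C) (hfs i hi)).2 (Or.inl rfl)
    exact ⟨B, hB, h⟩
  · intro i hi j hj hij
    rw [inSameBlock_oneBlock (hfs i hi), hfC i hi, hfC j hj, hf.injective.eq_iff]
    omega

lemma not_hasDoubletonCopy_image_singleton {s : Finset ℕ} {k a b : ℕ} (ha : 1 ≤ a) (hab : a < b)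
    (hb : b ≤ k) : ¬ HasDoubletonCopy k a b (s.image fun x => {x}) := by
  rintro ⟨f, hf, -, hfs⟩
  have ha' : a ∈ Idx k := mem_Idx.2 (by omega)
  have hb' : b ∈ Idx k := mem_Idx.2 (by omega)
  obtain ⟨B, hB, h1, h2⟩ := (hfs a ha' b hb' hab).2 ⟨rfl, rfl⟩
  obtain ⟨z, -, rfl⟩ := mem_image.1 hB
  have := hf ha' hb' hab
  rw [mem_singleton.1 h1, mem_singleton.1 h2] at this
  exact lt_irrefl _ this

lemma oneBlock_mem_erasedAvoiders {C s : Finset ℕ} {m k a b : ℕ} (hCs : C ⊆ s) (hmC : m ∈ C)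
    (ha : 1 ≤ a) (hab : a < b) (hb : b ≤ k) : oneBlock C s ∈ erasedAvoiders m k a b s := by
  have hP := isPartitionOf_oneBlock hCs ⟨m, hmC⟩
  refine mem_filter.2 ⟨mem_setParts.2 hP, fun B hB hmB => ?_⟩
  rw [hP.disj B hB C (mem_insert_self _ _) m hmB hmC, oneBlock_erase ⟨m, hmC⟩]
  exact not_hasDoubletonCopy_image_singleton ha hab hb

lemma card_doubletonAvoiders_lt_of_erased {C s : Finset ℕ} {m k a b a' b' : ℕ} (hm : m ∈ s)
    (hCs : C ⊆ s) (hmC : m ∈ C) (ha : 1 ≤ a) (hab : a < b) (hb : b ≤ k)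
    (hsub : ∀ P, IsPartitionOf s P → ∀ B ∈ P, m ∈ B → HasDoubletonCopy k a b (P.erase B) →
      HasDoubletonCopy (k + 1) a' b' P)
    (hC : HasDoubletonCopy (k + 1) a' b' (oneBlock C s)) :
    (doubletonAvoiders (k + 1) a' b' s).card < (fewBlocks s k).card := by
  obtain ⟨q, rfl⟩ : ∃ q, k = q + 1 := ⟨k - 1, by omega⟩
  refine lt_of_lt_of_le (card_lt_card ?_)
    (card_erasedAvoiders_le hm fun t => card_doubletonAvoiders_le ha hab hb t)
  refine Finset.ssubset_iff_subset_ne.2 ⟨fun P hP => ?_, fun heq => ?_⟩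
  · simp only [doubletonAvoiders, erasedAvoiders, mem_filter] at hP ⊢
    exact ⟨hP.1, fun B hB hmB h => hP.2 (hsub P (mem_setParts.1 hP.1) B hB hmB h)⟩
  · have := oneBlock_mem_erasedAvoiders hCs hmC ha hab hb
    rw [← heq] at this
    exact (mem_filter.1 this).2 hC

lemma card_gapAvoiders_Idx_lt {r n : ℕ} (hr : 2 ≤ r) (hn : r + 3 ≤ n) :
    (gapAvoiders r (Idx n)).card < (exactBlocks (Idx n) (r + 1)).card := by
  obtain ⟨t, rfl⟩ : ∃ t, n = t + r + 1 := ⟨n - r - 1, by omega⟩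
  set n := t + r + 1 with hn'
  have hnmem : n ∈ Idx n := mem_Idx.2 (by omega)
  set s := (Idx n).erase n with hs
  have hsmem : ∀ x, x ∈ s ↔ 1 ≤ x ∧ x < n := by
    intro x; rw [hs, mem_erase, mem_Idx]; omega
  set C := insert (t + 1) (Idx (t - 1)) with hC
  have hCmem : ∀ x, x ∈ C ↔ x = t + 1 ∨ (1 ≤ x ∧ x < t) := by
    intro x; rw [hC, mem_insert, mem_Idx]; omega
  have hCs : C ⊆ s := by
    intro x hx; rw [hCmem] at hx; rw [hsmem]; omega
  have h1C : 1 ∈ C := (hCmem 1).2 (by omega)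
  have hP := isPartitionOf_oneBlock hCs ⟨1, h1C⟩
  have hCcard : C.card = t := by
    rw [hC, card_insert_of_notMem (by rw [mem_Idx]; omega), Idx, Nat.card_Icc]; omega
  have hscard : s.card = t + r := by
    rw [hs, card_erase_of_mem hnmem, Idx, Nat.card_Icc]; omega
  have hPcard : (oneBlock C s).card = r + 1 := by
    rw [card_oneBlock hCs ⟨1, h1C⟩, hCcard, hscard]; omega
  have hCP : C ∈ oneBlock C s := mem_insert_self _ _
  have hts : t ∈ s \ C := by rw [mem_sdiff, hsmem, hCmem]; omega
  have htP : {t} ∈ oneBlock C s := mem_insert_of_mem (mem_image_of_mem _ hts)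
  have htC : {t} ≠ C := fun h => (mem_sdiff.1 hts).2 (h ▸ mem_singleton_self t)
  have hmax : ∀ y ∈ Idx n, y ≤ n := fun y hy => (mem_Idx.1 hy).2
  refine card_gapAvoiders_lt hnmem hmax (P := oneBlock C s)
    (mem_filter.2 ⟨mem_setParts.2 hP, hPcard.ge, ?_⟩) ?_
  · rintro ⟨f, hf, hfc, hfs⟩
    have hmem : ∀ i, 1 ≤ i → i ≤ r + 2 → i ∈ Idx (r + 2) := fun i h h' => mem_Idx.2 ⟨h, h'⟩
    have hfmem : ∀ i ∈ Idx (r + 2), f i ∈ s := by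
      intro i hi
      obtain ⟨B, hB, h⟩ := hfc i hi
      exact hP.sub B hB h
    have i1 := hmem 1 le_rfl (by omega)
    have i2 := hmem 2 (by omega) (by omega)
    have i3 := hmem 3 (by omega) (by omega)
    have i4 := hmem (r + 2) (by omega) le_rfl
    have hends := (hfs 1 i1 _ i4 (by omega)).2 ⟨rfl, rfl⟩
    have h12 := hf i1 i2 (by omega)
    have h23 := hf i2 i3 (by omega)
    have h34 := hf i3 i4 (by omega)
    rw [inSameBlock_oneBlock (hfmem 1 i1)] at hends
    have hout : ∀ i ∈ Idx (r + 2), 1 < i → i < r + 2 → f i ∉ C := by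
      intro i hi h h' hiC
      have := (hfs 1 i1 i hi h).1 ((inSameBlock_oneBlock (hfmem 1 i1)).2 (Or.inr
        ⟨(hends.resolve_left (by omega)).1, hiC⟩))
      omega
    have e4 := (hCmem _).1 (hends.resolve_left (by omega)).2
    have e1 := (hsmem _).1 (hfmem 1 i1)
    have e2 := hout 2 i2 (by omega) (by omega)
    have e3 := hout 3 i3 (by omega) (by omega)
    rw [hCmem] at e2 e3
    omega
  · have hsub : allowedJoins r n (oneBlock C s) ⊆ ((oneBlock C s).erase C).erase {t} := by
      intro B hB
      obtain ⟨hBP, hav⟩ := mem_filter.1 hB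
      refine mem_erase.2 ⟨?_, mem_erase.2 ⟨?_, hBP⟩⟩
      · rintro rfl
        refine hav (HasDoubletonCopy.of_joinBlock hP hnmem hmax htP (mem_singleton_self t)
          Subset.rfl (by rw [card_erase_of_mem htP]; omega) ?_)
        intro D hD
        obtain ⟨hDt, hD⟩ := mem_erase.1 hD
        rcases mem_insert.1 hD with rfl | hD
        · exact ⟨t + 1, mem_insert_self _ _, by omega⟩
        · obtain ⟨y, hy, rfl⟩ := mem_image.1 hD
          refine ⟨y, mem_singleton_self y, ?_⟩
          have hyt : y ≠ t := fun h => hDt (by rw [h])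
          rw [mem_sdiff, hsmem, hCmem] at hy
          omega
      · rintro rfl
        refine hav (HasDoubletonCopy.of_joinBlock hP hnmem hmax hCP h1C
          Subset.rfl (by rw [card_erase_of_mem hCP]; omega) ?_)
        intro D hD
        rw [oneBlock_erase ⟨1, h1C⟩] at hD
        obtain ⟨y, hy, rfl⟩ := mem_image.1 hD
        refine ⟨y, mem_singleton_self y, ?_⟩
        rw [mem_sdiff, hsmem, hCmem] at hy
        omega
    have := card_le_card hsub
    rw [card_erase_of_mem (mem_erase.2 ⟨htC, htP⟩), card_erase_of_mem hCP] at this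
    omega

lemma card_doubletonAvoiders_Idx_lt {k a b n : ℕ} (hk : 4 ≤ k) (ha : 1 ≤ a) (hab : a < b)
    (hb : b ≤ k) (hn : k < n) :
    (doubletonAvoiders k a b (Idx n)).card < (fewBlocks (Idx n) (k - 1)).card := by
  obtain ⟨k, rfl⟩ : ∃ k', k = k' + 1 := ⟨k - 1, by omega⟩
  rw [Nat.add_sub_cancel]
  by_cases ha1 : a = 1
  · by_cases hbk : b = k + 1
    · obtain ⟨r, rfl⟩ : ∃ r, k = r + 1 := ⟨k - 1, by omega⟩
      subst ha1 hbk
      have := card_gapAvoiders_Idx_lt (r := r) (n := n) (by omega) (by omega)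
      have := card_doubletonAvoiders_gap_le_add r (Idx n)
      have := card_fewBlocks_add_exactBlocks r (Idx n)
      change (doubletonAvoiders (r + 2) 1 (r + 2) (Idx n)).card < _
      omega
    · refine card_doubletonAvoiders_lt_of_erased (m := n) (a := a) (b := b)
        (C := (Idx n).filter fun j => j = a ∨ j = b ∨ k + 1 < j) (mem_Idx.2 (by omega))
        (filter_subset _ _) (mem_filter.2 ⟨mem_Idx.2 (by omega), by omega⟩) ha hab (by omega)
        (fun P hP B hB hmB h =>
          h.of_erase_max hP (fun x hx => (mem_Idx.1 hx).2) hB hmB (by omega))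
        (hasDoubletonCopy_oneBlock (f := id) strictMono_id ?_ ?_ hab)
      · intro i hi
        rw [mem_Idx] at *
        simp only [id]; omega
      · intro i hi
        rw [mem_filter]
        rw [mem_Idx] at *
        simp only [id]; omega
  · obtain ⟨a, rfl⟩ : ∃ a', a = a' + 1 := ⟨a - 1, by omega⟩
    obtain ⟨b, rfl⟩ : ∃ b', b = b' + 1 := ⟨b - 1, by omega⟩
    refine card_doubletonAvoiders_lt_of_erased (m := 1) (a := a) (b := b)
      (C := (Idx n).filter fun j => j = 1 ∨ j = a + 2 ∨ j = b + 2 ∨ k + 2 < j)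
      (mem_Idx.2 (by omega)) (filter_subset _ _)
      (mem_filter.2 ⟨mem_Idx.2 (by omega), by omega⟩) (by omega) (by omega) (by omega)
      (fun P hP B hB hmB h =>
        h.of_erase_min hP (fun x hx => (mem_Idx.1 hx).1) hB hmB (by omega))
      (hasDoubletonCopy_oneBlock (f := fun i => i + 1) (fun i j h => Nat.succ_lt_succ h) ?_ ?_ hab)
    · intro i hi
      rw [mem_Idx] at *
      omega
    · intro i hi
      rw [mem_filter]
      rw [mem_Idx] at *
      omega

lemma isPartitionOf_parts {s : Finset ℕ} (σ : Finpartition s) : IsPartitionOf s σ.parts where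
  nonempty _ hB := σ.nonempty_of_mem_parts hB
  sub _ hB := σ.le hB
  cover _ hx := σ.exists_mem hx
  disj _ hB _ hC _ hxB hxC := σ.eq_of_mem_parts hB hC hxB hxC

lemma IsPartitionOf.exists_finpartition {s : Finset ℕ} {P : Finset (Finset ℕ)}
    (hP : IsPartitionOf s P) : ∃ σ : Finpartition s, σ.parts = P := by
  refine ⟨⟨P, ?_, ?_, fun h => (hP.nonempty _ h).ne_empty rfl⟩, rfl⟩
  · rw [supIndep_iff_pairwiseDisjoint]
    intro B hB C hC hBC
    exact Finset.disjoint_left.2 fun x hxB hxC => hBC (hP.disj B hB C hC x hxB hxC)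
  · ext x
    simp only [mem_sup, id]
    constructor
    · rintro ⟨B, hB, hx⟩
      exact hP.sub B hB hx
    · exact hP.cover x

lemma natCard_finpartition {s : Finset ℕ} (p : Finset (Finset ℕ) → Prop) [DecidablePred p] :
    Nat.card {σ : Finpartition s // p σ.parts} = ((setParts s).filter p).card := by
  rw [← Nat.card_eq_finsetCard]
  refine Nat.card_congr (Equiv.ofBijective
    (fun σ => ⟨σ.1.parts, mem_filter.2 ⟨mem_setParts.2 (isPartitionOf_parts σ.1), σ.2⟩⟩) ⟨?_, ?_⟩)
  · intro σ τ h
    exact Subtype.ext (Finpartition.ext (congrArg Subtype.val h))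
  · rintro ⟨P, hP⟩
    obtain ⟨hP, hp⟩ := mem_filter.1 hP
    obtain ⟨σ, rfl⟩ := (mem_setParts.1 hP).exists_finpartition
    exact ⟨⟨σ, hp⟩, rfl⟩

lemma contains_of_hasDoubletonCopy {k n a b : ℕ} {δ : Finpartition (Idx k)}
    {σ : Finpartition (Idx n)}
    (hδ : ∀ i ∈ Idx k, ∀ j ∈ Idx k, i < j → (SameBlock δ i j ↔ i = a ∧ j = b))
    (h : HasDoubletonCopy k a b σ.parts) : Contains δ σ := by
  obtain ⟨f, hf, hfc, hfs⟩ := h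
  have hcomm : ∀ {m : ℕ} (π : Finpartition (Idx m)) i j, SameBlock π i j ↔ SameBlock π j i := by
    intro m π i j; simp only [SameBlock, and_comm]
  refine ⟨f, hf, ?_, ?_⟩
  · intro i hi
    obtain ⟨B, hB, h⟩ := hfc i hi
    exact σ.le hB h
  · intro i hi j hj
    rcases lt_trichotomy i j with hij | rfl | hij
    · exact (hδ i hi j hj hij).trans (hfs i hi j hj hij).symm
    · obtain ⟨B, hB, h⟩ := hfc i hi
      obtain ⟨D, hD, h'⟩ := δ.exists_mem hi
      exact iff_of_true ⟨D, hD, h', h'⟩ ⟨B, hB, h, h⟩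
    · rw [hcomm δ, hcomm σ]
      exact (hδ j hj i hi hij).trans (hfs j hj i hi hij).symm

lemma exists_doubleton {k : ℕ} {δ : Finpartition (Idx k)}
    (hδ1 : (δ.parts.filter (fun B => B.card = 2)).card = 1)
    (hδ2 : ∀ B ∈ δ.parts, B.card = 1 ∨ B.card = 2) :
    ∃ a b, 1 ≤ a ∧ a < b ∧ b ≤ k ∧
      ∀ i ∈ Idx k, ∀ j ∈ Idx k, i < j → (SameBlock δ i j ↔ i = a ∧ j = b) := by
  obtain ⟨D, hD⟩ := card_eq_one.1 hδ1
  have hDmem : D ∈ δ.parts ∧ D.card = 2 := mem_filter.1 (hD ▸ mem_singleton_self D)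
  obtain ⟨a, b, hab, hDab⟩ : ∃ a b, a < b ∧ D = {a, b} := by
    obtain ⟨x, y, hxy, h⟩ := card_eq_two.1 hDmem.2
    rcases lt_or_gt_of_ne hxy with hlt | hlt
    · exact ⟨x, y, hlt, h⟩
    · exact ⟨y, x, hlt, h.trans (pair_comm x y)⟩
  have haD : a ∈ D := by simp [hDab]
  have hbD : b ∈ D := by simp [hDab]
  refine ⟨a, b, (mem_Idx.1 (δ.le hDmem.1 haD)).1, hab, (mem_Idx.1 (δ.le hDmem.1 hbD)).2, ?_⟩
  intro i hi j hj hij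
  constructor
  · rintro ⟨B, hB, hiB, hjB⟩
    have h2 : B.card = 2 := by
      have := one_lt_card.2 ⟨i, hiB, j, hjB, hij.ne⟩
      rcases hδ2 B hB with h | h <;> omega
    have hBD : B = D := mem_singleton.1 (hD ▸ mem_filter.2 ⟨hB, h2⟩)
    rw [hBD, hDab, mem_insert, mem_singleton] at hiB hjB
    omega
  · rintro ⟨rfl, rfl⟩
    exact ⟨D, hDmem.1, haD, hbD⟩

lemma contains_singletons_iff {k n : ℕ} {σk : Finpartition (Idx k)} {σ : Finpartition (Idx n)}
    (hσk : σk.parts = (Idx k).image (fun x => {x})) :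
    Contains σk σ ↔ k ≤ σ.parts.card := by
  have hsb : ∀ i ∈ Idx k, ∀ j, SameBlock σk i j ↔ i = j := by
    intro i hi j
    rw [SameBlock, hσk]
    constructor
    · rintro ⟨B, hB, h1, h2⟩
      obtain ⟨z, -, rfl⟩ := mem_image.1 hB
      exact (mem_singleton.1 h1).trans (mem_singleton.1 h2).symm
    · rintro rfl
      exact ⟨{i}, mem_image_of_mem _ hi, by simp⟩
  constructor
  · rintro ⟨f, hf, hfn, hfs⟩
    have hk : (Idx k).card = k := by simp [Idx]
    rw [← hk]
    refine card_le_card_of_injOn (fun i => σ.part (f i)) (fun i hi => ?_) ?_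
    · exact σ.part_mem.2 (hfn i hi)
    · intro i hi j hj hij
      refine (hsb i hi j).1 ((hfs i hi j hj).2 ⟨σ.part (f i), σ.part_mem.2 (hfn i hi), ?_, ?_⟩)
      · exact σ.mem_part (hfn i hi)
      · dsimp only at hij
        rw [hij]
        exact σ.mem_part (hfn j hj)
  · intro hcard
    obtain ⟨𝒟, h𝒟, h𝒟c⟩ := exists_subset_card_eq hcard
    choose! g hg using fun B (hB : B ∈ σ.parts) => σ.nonempty_of_mem_parts hB
    have hg' : ∀ B ∈ 𝒟, ∀ C ∈ 𝒟, ∀ D ∈ σ.parts, g B ∈ D → g C ∈ D → B = C := by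
      intro B hB C hC D hD h1 h2
      rw [σ.eq_of_mem_parts (h𝒟 hB) hD (hg B (h𝒟 hB)) h1,
        σ.eq_of_mem_parts (h𝒟 hC) hD (hg C (h𝒟 hC)) h2]
    have hKc : (𝒟.image g).card = k := by
      rw [card_image_of_injOn, h𝒟c]
      intro B hB C hC h
      exact hg' B hB C hC B (h𝒟 hB) (hg B (h𝒟 hB)) (h ▸ hg B (h𝒟 hB))
    obtain ⟨f, hf, hfK, -⟩ := exists_enumeration _ hKc
    refine ⟨f, hf, ?_, ?_⟩
    · intro i hi
      obtain ⟨B, hB, h⟩ := mem_image.1 (hfK i hi)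
      exact h ▸ σ.le (h𝒟 hB) (hg B (h𝒟 hB))
    · intro i hi j hj
      rw [hsb i hi]
      obtain ⟨B, hB, h⟩ := mem_image.1 (hfK i hi)
      obtain ⟨C, hC, h'⟩ := mem_image.1 (hfK j hj)
      constructor
      · rintro rfl
        exact ⟨B, h𝒟 hB, h ▸ hg B (h𝒟 hB), h ▸ hg B (h𝒟 hB)⟩
      · rintro ⟨D, hD, h1, h2⟩
        have := hg' B hB C hC D hD (h ▸ h1) (h' ▸ h2)
        subst this
        exact hf.injOn hi hj (h.symm.trans h')

lemma exists_card_le_of_contains_block {k n : ℕ} (hk : 1 ≤ k) {βk : Finpartition (Idx k)}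
    {σ : Finpartition (Idx n)} (hβk : βk.parts = {Idx k}) (h : Contains βk σ) :
    ∃ B ∈ σ.parts, k ≤ B.card := by
  obtain ⟨f, hf, hfn, hfs⟩ := h
  have h1 : 1 ∈ Idx k := mem_Idx.2 ⟨le_rfl, hk⟩
  have hsb : ∀ i ∈ Idx k, SameBlock σ (f 1) (f i) := fun i hi =>
    (hfs 1 h1 i hi).1 ⟨Idx k, by simp [hβk], h1, hi⟩
  obtain ⟨B, hB, hB1, -⟩ := hsb 1 h1
  refine ⟨B, hB, ?_⟩
  have hk : (Idx k).card = k := by simp [Idx]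
  rw [← hk]
  refine card_le_card_of_injOn f (fun i hi => ?_) hf.injOn
  obtain ⟨C, hC, hC1, hCi⟩ := hsb i hi
  exact σ.eq_of_mem_parts hC hB hC1 hB1 ▸ hCi

end SetPartitionFamilies

/-- If `δ ⊢ [k]` has exactly one doubleton block and all other blocks singletons, then
`|Π_n(δ)| < |Π_n(σ_k)| < |Π_n(β_k)|` for all `n > k ≥ 4`. -/
theorem avoidCount_oneDoubleton_lt_singletons_lt_beta (k : ℕ) (hk : 4 ≤ k)
    (δ : Finpartition (Idx k))
    (hδ1 : (δ.parts.filter (fun B => B.card = 2)).card = 1)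
    (hδ2 : ∀ B ∈ δ.parts, B.card = 1 ∨ B.card = 2)
    (σk βk : Finpartition (Idx k))
    (hσk : σk.parts = (Idx k).image (fun x => {x}))
    (hβk : βk.parts = {Idx k}) :
    ∀ n : ℕ, k < n →
      avoidCount n δ < avoidCount n σk ∧ avoidCount n σk < avoidCount n βk := by
  classical
  intro n hn
  have hσ : avoidCount n σk = (fewBlocks (Idx n) (k - 1)).card := by
    rw [fewBlocks, ← natCard_finpartition, avoidCount]
    refine Nat.card_congr (Equiv.subtypeEquivRight fun σ => ?_)
    rw [Avoids, contains_singletons_iff hσk]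
    omega
  constructor
  · obtain ⟨a, b, ha, hab, hb, hδ⟩ := exists_doubleton hδ1 hδ2
    rw [hσ]
    refine lt_of_le_of_lt ?_ (card_doubletonAvoiders_Idx_lt hk ha hab hb hn)
    rw [doubletonAvoiders, ← natCard_finpartition, avoidCount]
    exact Nat.card_le_card_of_injective
      (Subtype.map id fun σ h hc => h (contains_of_hasDoubletonCopy hδ hc))
      (Subtype.map_injective _ Function.injective_id)
  · obtain ⟨q, rfl⟩ : ∃ q, k = q + 2 := ⟨k - 2, by omega⟩
    rw [hσ]
    refine (card_fewBlocks_lt_card_smallBlocks (q := q) (by omega)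
      (by rw [Idx, Nat.card_Icc]; omega)).trans_le ?_
    rw [smallBlocks, ← natCard_finpartition, avoidCount]
    refine Nat.card_le_card_of_injective (Subtype.map id fun σ h hc => ?_)
      (Subtype.map_injective _ Function.injective_id)
    obtain ⟨B, hB, hBk⟩ := exists_card_le_of_contains_block (by omega) hβk hc
    have := h B hB
    simp only [id] at *
    omega
end

section
/- For every n ≥ 1, the number of set partitions of [n] avoiding 12/34 is given by |Π_n(12/34)| = ∑_{k=0}^{⌊n/2⌋} ( k!·C(n,2k) + ∑_{ℓ=3}^{n−2k} C(n,2k+ℓ)·k!·(k+1)² ), where C(a,b) denotes the binomial coefficient. -/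
open Finset

section BlockMinima

variable {α : Type*} [LinearOrder α]

/-- `U < M < V` elementwise, and `U` and `V` have the same size. -/
structure Layered (U M V : Finset α) : Prop where
  lt_mid : ∀ u ∈ U, ∀ m ∈ M, u < m
  mid_lt : ∀ m ∈ M, ∀ v ∈ V, m < v
  lt_top : ∀ u ∈ U, ∀ v ∈ V, u < v
  card_eq : #U = #V

/-- `g` sends every element to the minimum of its block, for a set partition that avoids
`12/34`. -/
structure IsAvoidingRep (g : α → α) : Prop where
  idem : ∀ x, g (g x) = g x
  le : ∀ x, g x ≤ x
  avoid : ∀ a b c d, a < b → b < c → c < d → g a = g b → g c = g d → g a = g c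

/-- `g` matches `V` with `U`, sends all of `M` to one element of `U`, and fixes everything
else. -/
structure IsLayerMap (U M V : Finset α) (g : α → α) : Prop where
  bijOn : Set.BijOn g V U
  mapsTo_mid : ∀ x ∈ M, g x ∈ U
  const_mid : ∀ x ∈ M, ∀ y ∈ M, g x = g y
  fix : ∀ x, x ∉ M → x ∉ V → g x = x

theorem eq_of_initial_segments {A B T : Finset α} (hA : A ⊆ T) (hB : B ⊆ T)
    (hA' : ∀ a ∈ A, ∀ x ∈ T, x ∉ A → a < x) (hB' : ∀ b ∈ B, ∀ x ∈ T, x ∉ B → b < x)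
    (hc : #A = #B) : A = B := by
  by_contra hne
  have h1 : ¬ A ⊆ B := fun h => hne (Finset.eq_of_subset_of_card_le h hc.ge)
  have h2 : ¬ B ⊆ A := fun h => hne (Finset.eq_of_subset_of_card_le h hc.le).symm
  obtain ⟨x, hxA, hxB⟩ := Finset.not_subset.1 h1
  obtain ⟨y, hyB, hyA⟩ := Finset.not_subset.1 h2
  exact lt_asymm (hA' x hxA y (hB hyB) hyA) (hB' y hyB x (hA hxA) hxB)

theorem exists_initial_segment (T : Finset α) (j : ℕ) (hj : j ≤ #T) :
    ∃ A ⊆ T, #A = j ∧ ∀ a ∈ A, ∀ x ∈ T, x ∉ A → a < x := by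
  induction j with
  | zero => exact ⟨∅, by simp, by simp, by simp⟩
  | succ j ih =>
    obtain ⟨A, hAT, hc, hA⟩ := ih (by omega)
    have hne : (T \ A).Nonempty := by
      rw [← Finset.card_pos, Finset.card_sdiff_of_subset hAT]
      omega
    have hm := Finset.min'_mem _ hne
    set m := (T \ A).min' hne with hm_def
    rw [Finset.mem_sdiff] at hm
    refine ⟨insert m A, Finset.insert_subset hm.1 hAT, ?_, ?_⟩
    · rw [Finset.card_insert_of_notMem hm.2, hc]
    · intro a ha x hx hxn
      rw [Finset.mem_insert, not_or] at hxn
      rcases Finset.mem_insert.1 ha with rfl | ha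
      · exact lt_of_le_of_ne (Finset.min'_le _ _ (Finset.mem_sdiff.2 ⟨hx, hxn.2⟩))
          (Ne.symm hxn.1)
      · exact hA a ha x hx hxn.2

theorem exists_layered (T : Finset α) (j : ℕ) (hj : 2 * j ≤ #T) :
    ∃ U M V : Finset α, Layered U M V ∧ U ∪ M ∪ V = T ∧ #U = j ∧ #M = #T - 2 * j := by
  obtain ⟨A, hAT, hAc, hA⟩ := exists_initial_segment T (#T - j) (by omega)
  obtain ⟨U, hUA, hUc, hU⟩ := exists_initial_segment A j (by omega)
  refine ⟨U, A \ U, T \ A, ⟨?_, ?_, ?_, ?_⟩, ?_, hUc, ?_⟩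
  · intro u hu m hm
    rw [Finset.mem_sdiff] at hm
    exact hU u hu m hm.1 hm.2
  · intro m hm v hv
    rw [Finset.mem_sdiff] at hm hv
    exact hA m hm.1 v hv.1 hv.2
  · intro u hu v hv
    rw [Finset.mem_sdiff] at hv
    exact hA u (hUA hu) v hv.1 hv.2
  · rw [Finset.card_sdiff_of_subset hAT]
    omega
  · rw [Finset.union_sdiff_of_subset hUA, Finset.union_sdiff_of_subset hAT]
  · rw [Finset.card_sdiff_of_subset hUA]
    omega

theorem Layered.disjoint {U M V : Finset α} (h : Layered U M V) :
    Disjoint U M ∧ Disjoint M V ∧ Disjoint U V :=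
  ⟨Finset.disjoint_left.2 fun x hx hy => lt_irrefl _ (h.lt_mid x hx x hy),
    Finset.disjoint_left.2 fun x hx hy => lt_irrefl _ (h.mid_lt x hx x hy),
    Finset.disjoint_left.2 fun x hx hy => lt_irrefl _ (h.lt_top x hx x hy)⟩

theorem Layered.card_union {U M V : Finset α} (h : Layered U M V) :
    #(U ∪ M ∪ V) = 2 * #U + #M := by
  obtain ⟨h1, h2, h3⟩ := h.disjoint
  rw [Finset.card_union_of_disjoint (Finset.disjoint_union_left.2 ⟨h3, h2⟩),
    Finset.card_union_of_disjoint h1, ← h.card_eq]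
  ring

theorem Layered.unique {U M V U' M' V' : Finset α} (h : Layered U M V) (h' : Layered U' M' V')
    (hT : U ∪ M ∪ V = U' ∪ M' ∪ V') (hc : #U = #U') : U = U' ∧ M = M' ∧ V = V' := by
  have hU : U = U' := by
    refine eq_of_initial_segments (T := U ∪ M ∪ V) (by grind) (by grind) ?_ ?_ hc
    · intro a ha x hx hxU
      have := h.lt_mid a ha x
      have := h.lt_top a ha x
      grind
    · intro a ha x hx hxU
      have := h'.lt_mid a ha x
      have := h'.lt_top a ha x
      grind
  have hM : #M = #M' := by
    have h1 := h.card_union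
    have h2 := h'.card_union
    rw [hT] at h1
    omega
  have hUM : U ∪ M = U' ∪ M' := by
    refine eq_of_initial_segments (T := U ∪ M ∪ V) (by grind) (by grind) ?_ ?_ ?_
    · intro a ha x hx hxU
      have := h.mid_lt a
      have := h.lt_top a
      grind
    · intro a ha x hx hxU
      have := h'.mid_lt a
      have := h'.lt_top a
      grind
    · rw [Finset.card_union_of_disjoint h.disjoint.1,
        Finset.card_union_of_disjoint h'.disjoint.1, hc, hM]
  obtain ⟨h1, h2, h3⟩ := h.disjoint
  obtain ⟨h4, h5, h6⟩ := h'.disjoint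
  rw [Finset.disjoint_left] at h1 h2 h3 h4 h5 h6
  refine ⟨hU, ?_, ?_⟩
  · ext x
    have := congrArg (x ∈ ·) hU
    have := congrArg (x ∈ ·) hUM
    have := @h1 x
    have := @h4 x
    grind
  · ext x
    have := congrArg (x ∈ ·) hT
    have := congrArg (x ∈ ·) hUM
    have := @h2 x
    have := @h3 x
    have := @h5 x
    have := @h6 x
    grind

theorem IsLayerMap.isAvoidingRep {U M V : Finset α} (h : Layered U M V) {g : α → α}
    (hg : IsLayerMap U M V g) : IsAvoidingRep g := by
  have hV : ∀ x ∈ V, g x ∈ U := fun x hx => hg.bijOn.mapsTo hx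
  have hinj : ∀ x ∈ V, ∀ y ∈ V, g x = g y → x = y := fun x hx y hy => hg.bijOn.injOn hx hy
  obtain ⟨h1, h2, h3⟩ := h.disjoint
  rw [Finset.disjoint_left] at h1 h2 h3
  have hUfix : ∀ x ∈ U, g x = x := fun x hx => hg.fix x (h1 hx) (h3 hx)
  have hle : ∀ x, g x ≤ x := by
    intro x
    by_cases hM : x ∈ M
    · exact (h.lt_mid _ (hg.mapsTo_mid x hM) x hM).le
    by_cases hx : x ∈ V
    · exact (h.lt_top _ (hV x hx) x hx).le
    exact (hg.fix x hM hx).le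
  have hsnd : ∀ a b, a < b → g a = g b → b ∈ M ∨ b ∈ V := by
    intro a b hab hgab
    by_contra! hb
    rw [hg.fix b hb.1 hb.2] at hgab
    exact absurd (hle a) (by rw [hgab]; exact hab.not_ge)
  have hmem : ∀ x, x ∈ M ∨ x ∈ V → g x ∈ U := by
    rintro x (hx | hx)
    exacts [hg.mapsTo_mid x hx, hV x hx]
  refine ⟨?_, hle, ?_⟩
  · intro x
    by_cases hx : x ∈ M ∨ x ∈ V
    · exact hUfix _ (hmem x hx)
    · rw [not_or] at hx
      rw [hg.fix x hx.1 hx.2, hg.fix x hx.1 hx.2]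
  · intro a b c d hab hbc hcd hgab hgcd
    have hb := hsnd a b hab hgab
    have hd := hsnd c d hcd hgcd
    have hc : c ∈ M ∨ c ∈ V := by
      by_contra! hc
      have hcU : c ∈ U := by
        rw [← hg.fix c hc.1 hc.2, hgcd]
        exact hmem d hd
      rcases hb with hb | hb
      · exact lt_asymm hbc (h.lt_mid c hcU b hb)
      · exact lt_asymm hbc (h.lt_top c hcU b hb)
    have hcM : c ∈ M := by
      refine hc.resolve_right fun hcV => ?_
      rcases hd with hd | hd
      · exact lt_asymm hcd (h.mid_lt d hd c hcV)
      · exact hcd.ne (hinj c hcV d hd hgcd)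
    have hbM : b ∈ M := hb.resolve_right fun hbV => lt_asymm hbc (h.mid_lt c hcM b hbV)
    rw [hgab]
    exact hg.const_mid b hbM c hcM

theorem card_constant_maps (M U : Finset α) :
    Nat.card {f : M → U // ∀ x y, f x = f y} = if M = ∅ then 1 else #U := by
  split_ifs with h
  · subst h
    rw [Nat.card_eq_one_iff_unique]
    exact ⟨⟨fun a b => Subtype.ext (funext fun x => absurd x.2 (Finset.notMem_empty _))⟩,
      ⟨⟨fun x => absurd x.2 (Finset.notMem_empty _),
        fun x => absurd x.2 (Finset.notMem_empty _)⟩⟩⟩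
  · obtain ⟨m, hm⟩ := Finset.nonempty_iff_ne_empty.2 h
    let ev : {f : M → U // ∀ x y, f x = f y} → U := fun f => f.1 ⟨m, hm⟩
    have hev : Function.Bijective ev := by
      refine ⟨fun f g hfg => Subtype.ext (funext fun x => ?_), fun u => ⟨⟨fun _ => u, ?_⟩, rfl⟩⟩
      · rw [f.2 x ⟨m, hm⟩, g.2 x ⟨m, hm⟩]
        exact hfg
      · exact fun _ _ => rfl
    rw [Nat.card_congr (Equiv.ofBijective ev hev)]
    simp

theorem card_isLayerMap {U M V : Finset α} (h : Layered U M V) :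
    Nat.card {g : α → α // IsLayerMap U M V g} =
      (#U).factorial * if M = ∅ then 1 else #U := by
  classical
  rw [← card_constant_maps]
  have hcard : Nat.card (V ≃ U) = (#U).factorial := by
    rw [Nat.card_eq_fintype_card, Fintype.card_equiv (Finset.equivOfCardEq h.card_eq.symm)]
    simp [h.card_eq]
  rw [← hcard, ← Nat.card_prod]
  obtain ⟨h1, h2, h3⟩ := h.disjoint
  rw [Finset.disjoint_left] at h1 h2 h3
  let F : {g : α → α // IsLayerMap U M V g} → (V ≃ U) × {f : M → U // ∀ x y, f x = f y} :=
    fun g => (Set.BijOn.equiv g.1 g.2.bijOn,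
      ⟨fun x => ⟨g.1 x, g.2.mapsTo_mid x x.2⟩,
        fun x y => Subtype.ext (g.2.const_mid x x.2 y y.2)⟩)
  refine Nat.card_congr (Equiv.ofBijective F ⟨?_, ?_⟩)
  · rintro ⟨g, hg⟩ ⟨g', hg'⟩ hgg
    obtain ⟨hE, hW⟩ := Prod.ext_iff.1 hgg
    refine Subtype.ext (funext fun x => ?_)
    by_cases hM : x ∈ M
    · exact congrArg Subtype.val (congrFun (congrArg Subtype.val hW) ⟨x, hM⟩)
    by_cases hV : x ∈ V
    · exact congrArg Subtype.val (DFunLike.congr_fun hE ⟨x, hV⟩)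
    exact (hg.fix x hM hV).trans (hg'.fix x hM hV).symm
  · rintro ⟨e, f, hf⟩
    let g : α → α := fun x => if hV : x ∈ V then e ⟨x, hV⟩ else if hM : x ∈ M then f ⟨x, hM⟩ else x
    have gV : ∀ x (hx : x ∈ V), g x = e ⟨x, hx⟩ := fun x hx => by simp [g, hx]
    have gM : ∀ x (hx : x ∈ M), g x = f ⟨x, hx⟩ := fun x hx => by simp [g, hx, h2 hx]
    have hg : IsLayerMap U M V g := by
      refine ⟨⟨?_, ?_, ?_⟩, ?_, ?_, ?_⟩
      · intro x hx
        rw [gV x hx]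
        exact (e _).2
      · intro x hx y hy hxy
        rw [gV x hx, gV y hy] at hxy
        exact congrArg Subtype.val (e.injective (Subtype.ext hxy))
      · intro u hu
        refine ⟨e.symm ⟨u, hu⟩, (e.symm ⟨u, hu⟩).2, ?_⟩
        rw [gV _ (e.symm ⟨u, hu⟩).2]
        simp
      · intro x hx
        rw [gM x hx]
        exact (f _).2
      · intro x hx y hy
        rw [gM x hx, gM y hy, hf]
      · intro x hM hV
        simp [g, hM, hV]
    refine ⟨⟨g, hg⟩, Prod.ext (Equiv.ext fun x => Subtype.ext (gV x x.2))
      (Subtype.ext (funext fun x => Subtype.ext (gM x x.2)))⟩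

variable [Fintype α]

open scoped Classical in
/-- The union of the fibres of `g` that have at least two elements. -/
noncomputable def nonsingletons (g : α → α) : Finset α := {x | ∃ y, y ≠ x ∧ g y = g x}

open scoped Classical in
/-- The fixed points of `g` in fibres that have at least two elements. -/
noncomputable def openers (g : α → α) : Finset α := {x | g x = x ∧ ∃ y, y ≠ x ∧ g y = g x}

theorem IsLayerMap.openers_eq {U M V : Finset α} (h : Layered U M V) {g : α → α}
    (hg : IsLayerMap U M V g) : openers g = U := by
  obtain ⟨h1, h2, h3⟩ := h.disjoint
  rw [Finset.disjoint_left] at h1 h2 h3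
  ext x
  simp only [openers, Finset.mem_filter, Finset.mem_univ, true_and]
  constructor
  · rintro ⟨hx, y, hyx, hy⟩
    rw [hx] at hy
    by_cases hM : y ∈ M
    · exact hy ▸ hg.mapsTo_mid y hM
    by_cases hV : y ∈ V
    · exact hy ▸ hg.bijOn.mapsTo hV
    exact absurd ((hg.fix y hM hV).symm.trans hy) hyx
  · intro hx
    have hfix := hg.fix x (h1 hx) (h3 hx)
    obtain ⟨v, hv, hgv⟩ := hg.bijOn.surjOn hx
    exact ⟨hfix, v, (h.lt_top x hx v hv).ne', hgv.trans hfix.symm⟩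

theorem IsLayerMap.nonsingletons_eq {U M V : Finset α} (h : Layered U M V) {g : α → α}
    (hg : IsLayerMap U M V g) : nonsingletons g = U ∪ M ∪ V := by
  have hU := hg.openers_eq h
  have hr := hg.isAvoidingRep h
  ext x
  have hx : x ∈ openers g ↔ x ∈ U := by rw [hU]
  simp only [openers, Finset.mem_filter, Finset.mem_univ, true_and] at hx
  simp only [nonsingletons, Finset.mem_filter, Finset.mem_univ, true_and, Finset.mem_union]
  constructor
  · intro hxT
    by_cases hM : x ∈ M
    · tauto
    by_cases hV : x ∈ V
    · tauto
    exact Or.inl (Or.inl (hx.1 ⟨hg.fix x hM hV, hxT⟩))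
  · rintro ((hxU | hxM) | hxV)
    · exact (hx.2 hxU).2
    · exact ⟨g x, (h.lt_mid _ (hg.mapsTo_mid x hxM) x hxM).ne, hr.idem x⟩
    · exact ⟨g x, (h.lt_top _ (hg.bijOn.mapsTo hxV) x hxV).ne, hr.idem x⟩

theorem IsAvoidingRep.exists_layered {g : α → α} (hg : IsAvoidingRep g) :
    ∃ M V : Finset α, Layered (openers g) M V ∧ openers g ∪ M ∪ V = nonsingletons g ∧
      IsLayerMap (openers g) M V g := by
  classical
  have hUiff : ∀ x, x ∈ openers g ↔ g x = x ∧ x ∈ nonsingletons g := by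
    simp [openers, nonsingletons]
  have hTiff : ∀ x, x ∈ nonsingletons g ↔ ∃ y, y ≠ x ∧ g y = g x := by
    simp [nonsingletons]
  generalize openers g = U at *
  generalize nonsingletons g = T at *
  let V : Finset α := T.filter fun x => ∀ y, g y = g x → y ≤ x
  have hViff : ∀ x, x ∈ V ↔ x ∈ T ∧ ∀ y, g y = g x → y ≤ x := by simp [V]
  let M : Finset α := (T \ U) \ V
  have hMiff : ∀ x, x ∈ M ↔ x ∈ T ∧ x ∉ U ∧ x ∉ V := by
    intro x
    simp [M, and_assoc]
  have hUnext : ∀ u ∈ U, ∃ y, u < y ∧ g y = u := by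
    intro u hu
    obtain ⟨hfix, hT⟩ := (hUiff u).1 hu
    obtain ⟨y, hyu, hy⟩ := (hTiff u).1 hT
    rw [hfix] at hy
    exact ⟨y, lt_of_le_of_ne (hy ▸ hg.le y) (Ne.symm hyu), hy⟩
  have hVlt : ∀ v ∈ V, g v < v := by
    intro v hv
    obtain ⟨hT, hmax⟩ := (hViff v).1 hv
    refine lt_of_le_of_ne (hg.le v) fun hfix => ?_
    obtain ⟨y, hyu, hy⟩ := (hTiff v).1 hT
    exact hyu (le_antisymm (hmax y hy) (by rw [← hfix, ← hy]; exact hg.le y))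
  have hTU : ∀ x ∈ T, g x ∈ U := by
    intro x hx
    refine (hUiff _).2 ⟨hg.idem x, (hTiff _).2 ?_⟩
    rw [hg.idem]
    by_cases hxx : x = g x
    · rw [← hxx]
      obtain ⟨y, hy, hyx⟩ := (hTiff x).1 hx
      exact ⟨y, hy, by rw [hyx, ← hxx]⟩
    · exact ⟨x, hxx, rfl⟩
  have hMlt : ∀ x ∈ M, g x < x := by
    intro x hx
    obtain ⟨hT, hU, -⟩ := (hMiff x).1 hx
    exact lt_of_le_of_ne (hg.le x) fun h => hU ((hUiff x).2 ⟨h, hT⟩)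
  have hMnext : ∀ x ∈ M, ∃ y, x < y ∧ g y = g x := by
    intro x hx
    obtain ⟨hT, -, hV⟩ := (hMiff x).1 hx
    rw [hViff] at hV
    push Not at hV
    obtain ⟨y, hy, hxy⟩ := hV hT
    exact ⟨y, hxy, hy⟩
  have hMconst : ∀ x ∈ M, ∀ y ∈ M, x < y → g x = g y := by
    intro x hx y hy hxy
    obtain ⟨z, hyz, hz⟩ := hMnext y hy
    have := hg.avoid _ _ _ _ (hMlt x hx) hxy hyz (hg.idem x) hz.symm
    rwa [hg.idem] at this
  have hbij : Set.BijOn g V U := by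
    refine ⟨fun x hx => hTU x ((hViff x).1 hx).1, ?_, ?_⟩
    · intro x hx y hy hxy
      exact le_antisymm (((hViff y).1 hy).2 x hxy) (((hViff x).1 hx).2 y hxy.symm)
    · intro u hu
      have hne : (univ.filter fun y => g y = u).Nonempty :=
        ⟨u, by simpa using ((hUiff u).1 hu).1⟩
      have hm := Finset.max'_mem _ hne
      have hle := fun y hy => Finset.le_max' (univ.filter fun y => g y = u) y hy
      set v := (univ.filter fun y => g y = u).max' hne with hv
      simp only [Finset.mem_filter, Finset.mem_univ, true_and] at hm hle
      refine ⟨v, (hViff v).2 ⟨?_, fun y hy => hle y (hy.trans hm)⟩, hm⟩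
      obtain ⟨y, huy, hy⟩ := hUnext u hu
      have hyv := hle y hy
      exact (hTiff v).2 ⟨u, (huy.trans_le hyv).ne, by rw [hm]; exact ((hUiff u).1 hu).1⟩
  refine ⟨M, V, ⟨?_, ?_, ?_, ?_⟩, ?_, ⟨hbij, ?_, ?_, ?_⟩⟩
  · intro u hu m hm
    by_contra! hmu
    have hfix := ((hUiff u).1 hu).1
    have hne : m ≠ u := fun h => ((hMiff m).1 hm).2.1 (h ▸ hu)
    obtain ⟨y, huy, hy⟩ := hUnext u hu
    have := hg.avoid _ _ _ _ (hMlt m hm) (lt_of_le_of_ne hmu hne) huy (hg.idem m)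
      (hfix.trans hy.symm)
    rw [hg.idem, hfix] at this
    exact absurd (this ▸ hMlt m hm) hmu.not_gt
  · intro m hm v hv
    by_contra! hvm
    have hne : v ≠ m := fun h => ((hMiff m).1 hm).2.2 (h ▸ hv)
    obtain ⟨y, hmy, hy⟩ := hMnext m hm
    have := hg.avoid _ _ _ _ (hVlt v hv) (lt_of_le_of_ne hvm hne) hmy (hg.idem v) hy.symm
    rw [hg.idem] at this
    exact hne (le_antisymm hvm (((hViff v).1 hv).2 m this.symm))
  · intro u hu v hv
    by_contra! hvu
    have hfix := ((hUiff u).1 hu).1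
    have hne : v ≠ u := by
      rintro rfl
      exact (hVlt v hv).ne hfix
    obtain ⟨y, huy, hy⟩ := hUnext u hu
    have := hg.avoid _ _ _ _ (hVlt v hv) (lt_of_le_of_ne hvu hne) huy (hg.idem v)
      (hfix.trans hy.symm)
    rw [hg.idem] at this
    exact hne (le_antisymm hvu (((hViff v).1 hv).2 u this.symm))
  · exact (Finset.card_nbij g hbij.mapsTo hbij.injOn hbij.surjOn).symm
  · ext x
    have := hUiff x
    have := hViff x
    have := hMiff x
    simp only [Finset.mem_union]
    tauto
  · exact fun x hx => hTU x ((hMiff x).1 hx).1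
  · intro x hx y hy
    rcases lt_trichotomy x y with hxy | rfl | hxy
    · exact hMconst x hx y hy hxy
    · rfl
    · exact (hMconst y hy x hx hxy).symm
  · intro x hM hV
    by_cases hT : x ∈ T
    · have := hMiff x
      have := hUiff x
      tauto
    · by_contra hx
      exact hT ((hTiff x).2 ⟨g x, hx, hg.idem x⟩)

theorem card_fiber {T : Finset α} {j : ℕ} (hj : 2 * j ≤ #T) :
    Nat.card {g : α → α // IsAvoidingRep g ∧ nonsingletons g = T ∧ #(openers g) = j} =
      j.factorial * if #T = 2 * j then 1 else j := by
  obtain ⟨U, M, V, h, hT, hU, hM⟩ := exists_layered T j hj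
  have hM0 : M = ∅ ↔ #T = 2 * j := by
    rw [← Finset.card_eq_zero, hM]
    omega
  have hiff : ∀ g : α → α, (IsAvoidingRep g ∧ nonsingletons g = T ∧ #(openers g) = j) ↔
      IsLayerMap U M V g := by
    intro g
    constructor
    · rintro ⟨hg, hgT, hgU⟩
      obtain ⟨M', V', h', hT', hg'⟩ := hg.exists_layered
      obtain ⟨h1, rfl, rfl⟩ := h'.unique h (by rw [hT', hgT, hT]) (by rw [hgU, hU])
      rwa [← h1]
    · intro hg
      exact ⟨hg.isAvoidingRep h, by rw [hg.nonsingletons_eq h, hT], by rw [hg.openers_eq h, hU]⟩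
  rw [Nat.card_congr (Equiv.subtypeEquivRight hiff), card_isLayerMap h, hU]
  simp only [hM0]

theorem card_isAvoidingRep :
    Nat.card {g : α → α // IsAvoidingRep g} =
      ∑ T : Finset α, ∑ j ∈ range (#T / 2 + 1), j.factorial * if #T = 2 * j then 1 else j := by
  classical
  rw [Nat.card_eq_fintype_card, Fintype.card_subtype,
    Finset.card_eq_sum_card_fiberwise (f := nonsingletons) (t := univ) (by simp)]
  refine Finset.sum_congr rfl fun T _ => ?_
  rw [Finset.card_eq_sum_card_fiberwise (f := fun g => #(openers g)) (t := range (#T / 2 + 1))]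
  · refine Finset.sum_congr rfl fun j hj => ?_
    rw [Finset.mem_range] at hj
    rw [← card_fiber (T := T) (j := j) (by omega), Nat.card_eq_fintype_card,
      Fintype.card_subtype, Finset.filter_filter, Finset.filter_filter]
  · intro g hg
    simp only [Finset.coe_filter, Finset.mem_filter, Finset.mem_univ, true_and,
      Set.mem_ofPred_eq] at hg
    obtain ⟨M, V, h, hT, -⟩ := hg.1.exists_layered
    have := h.card_union
    rw [hT, hg.2] at this
    simp only [Finset.coe_range, Set.mem_Iio]
    omega

end BlockMinima

theorem sum_choose_factorial (n : ℕ) :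
    ∑ s ∈ range (n + 1), n.choose s *
        ∑ j ∈ range (s / 2 + 1), j.factorial * (if s = 2 * j then 1 else j) =
      ∑ k ∈ range (n / 2 + 1), (k.factorial * n.choose (2 * k) +
        ∑ l ∈ Icc 3 (n - 2 * k), n.choose (2 * k + l) * k.factorial * (k + 1) ^ 2) := by
  have hswap : ∑ s ∈ range (n + 1), n.choose s *
        ∑ j ∈ range (s / 2 + 1), j.factorial * (if s = 2 * j then 1 else j) =
      ∑ j ∈ range (n / 2 + 1), ∑ s ∈ Icc (2 * j) n,
        n.choose s * (j.factorial * if s = 2 * j then 1 else j) := by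
    simp only [Finset.mul_sum]
    refine Finset.sum_comm' fun s j => ?_
    simp only [Finset.mem_range, Finset.mem_Icc]
    omega
  have hsplit : ∀ j ∈ range (n / 2 + 1), ∑ s ∈ Icc (2 * j) n,
        n.choose s * (j.factorial * if s = 2 * j then 1 else j) =
      j.factorial * n.choose (2 * j) +
        ∑ s ∈ Icc (2 * j + 1) n, n.choose s * (j.factorial * j) := by
    intro j hj
    rw [Finset.mem_range] at hj
    rw [← Finset.add_sum_Ioc_eq_sum_Icc (by omega : 2 * j ≤ n), if_pos rfl]
    congr 1
    · ring
    · refine Finset.sum_congr (by ext; simp only [Finset.mem_Ioc, Finset.mem_Icc]; omega) fun s hs => ?_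
      rw [Finset.mem_Icc] at hs
      rw [if_neg (by omega)]
  rw [hswap, Finset.sum_congr rfl hsplit, Finset.sum_add_distrib, Finset.sum_add_distrib]
  congr 1
  rw [Finset.sum_range_succ', Finset.sum_range_succ,
    Finset.Icc_eq_empty (by omega : ¬ 3 ≤ n - 2 * (n / 2))]
  simp only [mul_zero, Finset.sum_const_zero, add_zero, Finset.sum_empty]
  refine Finset.sum_congr rfl fun k hk => ?_
  rw [Finset.mem_range] at hk
  refine Finset.sum_bij' (fun s _ => s - 2 * k) (fun l _ => 2 * k + l) ?_ ?_ ?_ ?_ ?_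
  · intro s hs
    rw [Finset.mem_Icc] at hs ⊢
    omega
  · intro l hl
    rw [Finset.mem_Icc] at hl ⊢
    omega
  · intro s hs
    rw [Finset.mem_Icc] at hs
    omega
  · intro l hl
    omega
  · intro s hs
    rw [Finset.mem_Icc] at hs
    rw [show 2 * k + (s - 2 * k) = s by omega, Nat.factorial_succ]
    ring

section SameBlock

variable {n : ℕ}

theorem SameBlock.left_mem {σ : Finpartition (Idx n)} {i j : ℕ} (h : SameBlock σ i j) :
    i ∈ Idx n := by
  obtain ⟨B, hB, hi, -⟩ := h
  exact σ.le hB hi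

theorem SameBlock.refl (σ : Finpartition (Idx n)) {i : ℕ} (h : i ∈ Idx n) : SameBlock σ i i :=
  ⟨σ.part i, σ.part_mem.2 h, σ.mem_part h, σ.mem_part h⟩

theorem SameBlock.symm {σ : Finpartition (Idx n)} {i j : ℕ} (h : SameBlock σ i j) :
    SameBlock σ j i := by
  obtain ⟨B, hB, hi, hj⟩ := h
  exact ⟨B, hB, hj, hi⟩

theorem SameBlock.trans {σ : Finpartition (Idx n)} {i j k : ℕ} (h : SameBlock σ i j)
    (h' : SameBlock σ j k) : SameBlock σ i k := by
  obtain ⟨B, hB, hi, hj⟩ := h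
  obtain ⟨C, hC, hj', hk⟩ := h'
  obtain rfl := σ.eq_of_mem_parts hB hC hj hj'
  exact ⟨B, hB, hi, hk⟩

theorem sameBlock_iff_mem_part {σ : Finpartition (Idx n)} {i j : ℕ} :
    SameBlock σ i j ↔ j ∈ σ.part i := by
  constructor
  · rintro ⟨B, hB, hi, hj⟩
    rwa [σ.part_eq_of_mem hB hi]
  · intro h
    have hi : i ∈ Idx n := by
      by_contra hi
      simp [σ.part_eq_empty.2 hi] at h
    exact ⟨σ.part i, σ.part_mem.2 hi, σ.mem_part hi, h⟩

theorem eq_of_sameBlock_iff {σ σ' : Finpartition (Idx n)}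
    (h : ∀ i j, SameBlock σ i j ↔ SameBlock σ' i j) : σ = σ' := by
  have hpart : ∀ i, σ.part i = σ'.part i := fun i => by
    ext j
    rw [← sameBlock_iff_mem_part, ← sameBlock_iff_mem_part, h]
  have key : ∀ ρ ρ' : Finpartition (Idx n), (∀ i, ρ.part i = ρ'.part i) →
      ρ.parts ⊆ ρ'.parts := by
    intro ρ ρ' hρ B hB
    obtain ⟨i, hi⟩ := ρ.nonempty_of_mem_parts hB
    rw [← ρ.part_eq_of_mem hB hi, hρ]
    exact ρ'.part_mem.2 (ρ.le hB hi)
  exact Finpartition.ext (Finset.Subset.antisymm (key σ σ' hpart)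
    (key σ' σ fun i => (hpart i).symm))

theorem avoids_iff {τ : Finpartition (Idx 4)} (hτ : τ.parts = {{1, 2}, {3, 4}})
    (σ : Finpartition (Idx n)) :
    Avoids σ τ ↔ ∀ a b c d, a < b → b < c → c < d →
      SameBlock σ a b → SameBlock σ c d → SameBlock σ a c := by
  have hτ' : ∀ i j, SameBlock τ i j ↔
      ((i = 1 ∨ i = 2) ∧ (j = 1 ∨ j = 2)) ∨ ((i = 3 ∨ i = 4) ∧ (j = 3 ∨ j = 4)) := by
    intro i j
    simp [SameBlock, hτ]
  constructor
  · intro h a b c d hab hbc hcd h1 h2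
    by_contra h3
    have ha := SameBlock.refl σ h1.left_mem
    have hb := SameBlock.refl σ h1.symm.left_mem
    have hc := SameBlock.refl σ h2.left_mem
    have hd := SameBlock.refl σ h2.symm.left_mem
    have had : ¬ SameBlock σ a d := fun h => h3 (h.trans h2.symm)
    have hbc' : ¬ SameBlock σ b c := fun h => h3 (h1.trans h)
    have hbd : ¬ SameBlock σ b d := fun h => had (h1.trans h)
    have h3' : ¬ SameBlock σ c a := fun h => h3 h.symm
    have had' : ¬ SameBlock σ d a := fun h => had h.symm
    have hcb : ¬ SameBlock σ c b := fun h => hbc' h.symm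
    have hdb : ¬ SameBlock σ d b := fun h => hbd h.symm
    refine h ⟨fun i => if i = 1 then a else if i = 2 then b else if i = 3 then c else d,
      ?_, ?_, ?_⟩
    · intro i hi j hj hij
      simp only [Idx, Finset.coe_Icc, Set.mem_Icc] at hi hj
      dsimp only
      split_ifs <;> omega
    · intro i hi
      dsimp only
      split_ifs
      exacts [ha.left_mem, hb.left_mem, hc.left_mem, hd.left_mem]
    · intro i hi j hj
      rw [hτ']
      simp only [Idx, Finset.mem_Icc] at hi hj
      obtain ⟨hi1, hi4⟩ := hi
      obtain ⟨hj1, hj4⟩ := hj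
      interval_cases i <;> interval_cases j <;>
        simp [h1, h1.symm, h2, h2.symm, h3, h3', ha, hb, hc, hd, had, had', hbc', hcb, hbd, hdb]
  · rintro h ⟨f, hmono, -, hf⟩
    have m1 : 1 ∈ Idx 4 := by simp [Idx]
    have m2 : 2 ∈ Idx 4 := by simp [Idx]
    have m3 : 3 ∈ Idx 4 := by simp [Idx]
    have m4 : 4 ∈ Idx 4 := by simp [Idx]
    have h13 := (hf 1 m1 3 m3).2 (h (f 1) (f 2) (f 3) (f 4) (hmono m1 m2 (by norm_num))
      (hmono m2 m3 (by norm_num)) (hmono m3 m4 (by norm_num))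
      ((hf 1 m1 2 m2).1 ((hτ' 1 2).2 (by norm_num)))
      ((hf 3 m3 4 m4).1 ((hτ' 3 4).2 (by norm_num))))
    rw [hτ'] at h13
    norm_num at h13

theorem exists_isAvoidingRep {σ : Finpartition (Idx n)}
    (hσ : ∀ a b c d, a < b → b < c → c < d →
      SameBlock σ a b → SameBlock σ c d → SameBlock σ a c) :
    ∃ g : Idx n → Idx n, IsAvoidingRep g ∧ ∀ x y : Idx n, SameBlock σ x y ↔ g x = g y := by
  have hne : ∀ x : Idx n, (σ.part x).Nonempty := fun x => ⟨x, σ.mem_part x.2⟩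
  have hblock : ∀ x : Idx n, SameBlock σ x ((σ.part x).min' (hne x)) := fun x =>
    sameBlock_iff_mem_part.2 (Finset.min'_mem _ _)
  let g : Idx n → Idx n := fun x => ⟨(σ.part x).min' (hne x), (hblock x).symm.left_mem⟩
  have hgx : ∀ x : Idx n, SameBlock σ x (g x) := hblock
  have hle : ∀ x y : Idx n, SameBlock σ x y → g x ≤ y := fun x y h =>
    Finset.min'_le _ _ (sameBlock_iff_mem_part.1 h)
  have hg : ∀ x y : Idx n, SameBlock σ x y ↔ g x = g y := by
    intro x y
    constructor
    · intro h
      exact le_antisymm (hle _ _ (h.trans (hgx y))) (hle _ _ (h.symm.trans (hgx x)))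
    · intro h
      exact (hgx x).trans (h ▸ (hgx y).symm)
  refine ⟨g, ⟨fun x => ((hg _ _).1 (hgx x)).symm, fun x => hle x x (SameBlock.refl σ x.2), ?_⟩,
    hg⟩
  intro a b c d hab hbc hcd h1 h2
  exact (hg a c).1 (hσ a b c d hab hbc hcd ((hg a b).2 h1) ((hg c d).2 h2))

theorem IsAvoidingRep.eq_of_ker_eq {α : Type*} [LinearOrder α] {g g' : α → α}
    (hg : IsAvoidingRep g) (hg' : IsAvoidingRep g') (h : ∀ x y, g x = g y ↔ g' x = g' y) :
    g = g' := by
  funext x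
  refine le_antisymm ?_ ?_
  · rw [← (h _ _).2 (hg'.idem x)]
    exact hg.le _
  · rw [← (h _ _).1 (hg.idem x)]
    exact hg'.le _

theorem exists_finpartition_sameBlock_iff (g : Idx n → Idx n) :
    ∃ σ : Finpartition (Idx n), ∀ x y : Idx n, SameBlock σ x y ↔ g x = g y := by
  classical
  let g' : ℕ → ℕ := fun x => if h : x ∈ Idx n then g ⟨x, h⟩ else 0
  refine ⟨Finpartition.ofSetSetoid (Setoid.ker g') (Idx n), fun x y => ?_⟩
  rw [sameBlock_iff_mem_part, Finpartition.mem_part_ofSetSetoid_iff_rel]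
  have hg' : ∀ z : Idx n, g' z = g z := fun z => dif_pos z.2
  rw [Setoid.ker_def, hg', hg', ← Subtype.ext_iff]
  exact ⟨fun h => h.2.2, fun h => ⟨x.2, y.2, h⟩⟩

theorem avoidCount_eq_card_isAvoidingRep {τ : Finpartition (Idx 4)}
    (hτ : τ.parts = {{1, 2}, {3, 4}}) :
    avoidCount n τ = Nat.card {g : Idx n → Idx n // IsAvoidingRep g} := by
  have hex : ∀ σ : {σ : Finpartition (Idx n) // Avoids σ τ}, ∃ g : Idx n → Idx n,
      IsAvoidingRep g ∧ ∀ x y : Idx n, SameBlock σ.1 x y ↔ g x = g y := fun σ =>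
    exists_isAvoidingRep ((avoids_iff hτ σ.1).1 σ.2)
  choose F hF hFg using hex
  refine Nat.card_congr (Equiv.ofBijective (fun σ => ⟨F σ, hF σ⟩) ⟨?_, ?_⟩)
  · intro σ σ' h
    have hFF : F σ = F σ' := congrArg Subtype.val h
    refine Subtype.ext (eq_of_sameBlock_iff fun i j => ?_)
    constructor
    · intro hij
      exact (hFg σ' ⟨i, hij.left_mem⟩ ⟨j, hij.symm.left_mem⟩).2
        (hFF ▸ (hFg σ ⟨i, hij.left_mem⟩ ⟨j, hij.symm.left_mem⟩).1 hij)
    · intro hij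
      exact (hFg σ ⟨i, hij.left_mem⟩ ⟨j, hij.symm.left_mem⟩).2
        (hFF ▸ (hFg σ' ⟨i, hij.left_mem⟩ ⟨j, hij.symm.left_mem⟩).1 hij)
  · rintro ⟨g, hg⟩
    obtain ⟨σ, hσ⟩ := exists_finpartition_sameBlock_iff g
    have hav : Avoids σ τ := by
      rw [avoids_iff hτ]
      intro a b c d hab hbc hcd h1 h2
      exact (hσ ⟨a, h1.left_mem⟩ ⟨c, h2.left_mem⟩).2
        (hg.avoid ⟨a, h1.left_mem⟩ ⟨b, h1.symm.left_mem⟩ ⟨c, h2.left_mem⟩ ⟨d, h2.symm.left_mem⟩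
          hab hbc hcd ((hσ _ _).1 h1) ((hσ _ _).1 h2))
    exact ⟨⟨σ, hav⟩, Subtype.ext ((hF _).eq_of_ker_eq hg fun x y =>
      (hFg ⟨σ, hav⟩ x y).symm.trans (hσ x y))⟩

end SameBlock

/-- Enumeration of the pattern `12/34`:
`|Π_n(12/34)| = ∑_{k=0}^{⌊n/2⌋} (k!·C(n,2k) + ∑_{ℓ=3}^{n-2k} C(n,2k+ℓ)·k!·(k+1)²)`. -/
theorem avoidCount_12_34 (τ : Finpartition (Idx 4))
    (hτ : τ.parts = {{1, 2}, {3, 4}}) (n : ℕ) (hn : 1 ≤ n) :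
    avoidCount n τ =
      ∑ k ∈ Finset.range (n / 2 + 1),
        (Nat.factorial k * Nat.choose n (2 * k) +
          ∑ l ∈ Finset.Icc 3 (n - 2 * k),
            Nat.choose n (2 * k + l) * Nat.factorial k * (k + 1) ^ 2) := by
  rw [avoidCount_eq_card_isAvoidingRep hτ, card_isAvoidingRep, ← Finset.powerset_univ,
    Finset.sum_powerset_apply_card
      (fun s => ∑ j ∈ range (s / 2 + 1), j.factorial * if s = 2 * j then 1 else j)]
  have hcard : #(univ : Finset (Idx n)) = n := by
    rw [Finset.card_univ, Fintype.card_coe, Idx, Nat.card_Icc, Nat.add_sub_cancel]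
  simp only [hcard, smul_eq_mul]
  exact sum_choose_factorial n
end

section
/- Any set partition of [n] which avoids 12/34 has at most one block of size greater than 2. -/
open Finset

/-- Three elements of a finite set of naturals with more than two elements, in increasing order. -/
theorem exists_lt_lt_of_two_lt_card {B : Finset ℕ} (hB : 2 < B.card) :
    ∃ x ∈ B, ∃ y ∈ B, ∃ z ∈ B, x < y ∧ y < z := by
  let e := B.orderEmbOfFin rfl
  refine ⟨e ⟨0, by omega⟩, B.orderEmbOfFin_mem rfl _, e ⟨1, by omega⟩, B.orderEmbOfFin_mem rfl _,
    e ⟨2, by omega⟩, B.orderEmbOfFin_mem rfl _, ?_, ?_⟩ <;>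
  exact e.strictMono (by simp [Fin.lt_def])

/-- Elements of known blocks lie in the same block iff these blocks are equal. -/
theorem sameBlock_iff_of_mem {n : ℕ} {π : Finpartition (Idx n)} {B C : Finset ℕ} {i j : ℕ}
    (hB : B ∈ π.parts) (hC : C ∈ π.parts) (hi : i ∈ B) (hj : j ∈ C) :
    SameBlock π i j ↔ B = C := by
  constructor
  · rintro ⟨D, hD, hiD, hjD⟩
    exact (π.eq_of_mem_parts hB hD hi hiD).trans (π.eq_of_mem_parts hD hC hjD hj)
  · rintro rfl
    exact ⟨B, hB, hi, hj⟩

/-- Two elements of one block below two elements of another form a copy of `12/34`. -/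
theorem contains_12_34_of_lt {n : ℕ} {τ : Finpartition (Idx 4)}
    (hτ : τ.parts = {{1, 2}, {3, 4}}) {π : Finpartition (Idx n)} {B C : Finset ℕ}
    (hB : B ∈ π.parts) (hC : C ∈ π.parts) (hBC : B ≠ C) {a b c d : ℕ}
    (ha : a ∈ B) (hb : b ∈ B) (hc : c ∈ C) (hd : d ∈ C)
    (hab : a < b) (hbc : b < c) (hcd : c < d) : Contains τ π := by
  let f : ℕ → ℕ := fun i => if i = 1 then a else if i = 2 then b else if i = 3 then c else d
  have hblock : ∀ i ∈ Idx 4, (if i ≤ 2 then ({1, 2} : Finset ℕ) else {3, 4}) ∈ τ.parts ∧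
      i ∈ (if i ≤ 2 then ({1, 2} : Finset ℕ) else {3, 4}) ∧
      (if i ≤ 2 then B else C) ∈ π.parts ∧ f i ∈ (if i ≤ 2 then B else C) := by
    intro i hi
    obtain ⟨h1, h4⟩ := Finset.mem_Icc.mp hi
    interval_cases i <;> simp [f, *]
  have hne : ({1, 2} : Finset ℕ) ≠ {3, 4} := by decide
  refine ⟨f, ?_, fun i hi => ?_, fun i hi j hj => ?_⟩
  · intro i hi j hj hij
    obtain ⟨h1, h4⟩ := Finset.mem_Icc.mp hi
    obtain ⟨h1', h4'⟩ := Finset.mem_Icc.mp hj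
    dsimp only [f]
    split_ifs <;> omega
  · obtain ⟨-, -, hD, hfi⟩ := hblock i hi
    exact π.le hD hfi
  · obtain ⟨hi₁, hi₂, hi₃, hi₄⟩ := hblock i hi
    obtain ⟨hj₁, hj₂, hj₃, hj₄⟩ := hblock j hj
    rw [sameBlock_iff_of_mem hi₁ hj₁ hi₂ hj₂, sameBlock_iff_of_mem hi₃ hj₃ hi₄ hj₄]
    split_ifs <;> simp [hne, hne.symm, hBC, hBC.symm]

/-- A set partition avoiding `12/34` has at most one block of size greater than `2`. -/
theorem avoids_12_34_at_most_one_big_block (n : ℕ) (τ : Finpartition (Idx 4))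
    (hτ : τ.parts = {{1, 2}, {3, 4}})
    (π : Finpartition (Idx n)) (hπ : Avoids π τ) :
    ∀ B ∈ π.parts, ∀ C ∈ π.parts, 2 < B.card → 2 < C.card → B = C := by
  intro B hB C hC hB₂ hC₂
  by_contra hne
  obtain ⟨b₁, hb₁, b₂, hb₂, b₃, hb₃, hb₁₂, hb₂₃⟩ := exists_lt_lt_of_two_lt_card hB₂
  obtain ⟨c₁, hc₁, c₂, hc₂, c₃, hc₃, hc₁₂, hc₂₃⟩ := exists_lt_lt_of_two_lt_card hC₂
  rcases lt_trichotomy b₂ c₂ with h | rfl | h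
  · exact hπ (contains_12_34_of_lt hτ hB hC hne hb₁ hb₂ hc₂ hc₃ hb₁₂ h hc₂₃)
  · exact hne (π.eq_of_mem_parts hB hC hb₂ hc₂)
  · exact hπ (contains_12_34_of_lt hτ hC hB (Ne.symm hne) hc₁ hc₂ hb₂ hb₃ hc₁₂ h hb₂₃)
end

section
/- A set partition π of [n] avoids 134/2 if and only if every block of π of size at least 2 has the form {a, a+1, …, a+ℓ, b} for some ℓ ≥ 0 and some b ≥ a+ℓ+1; that is, every non-singleton block consists of a set of consecutive integers together with one additional (largest) element. -/
open Finset

theorem sameBlock_iff_mem {n : ℕ} {π : Finpartition (Idx n)} {B : Finset ℕ}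
    (hB : B ∈ π.parts) {i j : ℕ} (hi : i ∈ B) : SameBlock π i j ↔ j ∈ B := by
  constructor
  · rintro ⟨C, hC, hiC, hjC⟩
    rwa [π.eq_of_mem_parts hB hC hi hiC]
  · exact fun hj => ⟨B, hB, hi, hj⟩

theorem sameBlock_comm {n : ℕ} {π : Finpartition (Idx n)} {i j : ℕ} :
    SameBlock π i j ↔ SameBlock π j i :=
  ⟨fun ⟨B, hB, hi, hj⟩ => ⟨B, hB, hj, hi⟩, fun ⟨B, hB, hj, hi⟩ => ⟨B, hB, hi, hj⟩⟩

theorem sameBlock_self {n : ℕ} (π : Finpartition (Idx n)) {i : ℕ} (hi : i ∈ Idx n) :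
    SameBlock π i i :=
  let ⟨B, hB, hiB⟩ := π.exists_mem hi
  ⟨B, hB, hiB, hiB⟩

/-- Containment of `134/2`, expressed inside a single block. -/
theorem contains_134_2_iff {n : ℕ} {τ : Finpartition (Idx 4)}
    (hτ : τ.parts = {{1, 3, 4}, {2}}) (π : Finpartition (Idx n)) :
    Contains τ π ↔ ∃ B ∈ π.parts, ∃ x ∈ B, ∃ z ∈ B, ∃ w ∈ B, ∃ y ∉ B,
      x < y ∧ y < z ∧ z < w := by
  constructor
  · rintro ⟨f, hmono, -, hf⟩
    have mem : ∀ i, 1 ≤ i → i ≤ 4 → i ∈ Idx 4 := fun i h₁ h₂ => Finset.mem_Icc.2 ⟨h₁, h₂⟩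
    have lt : ∀ i, 1 ≤ i → i < 4 → f i < f (i + 1) := fun i h₁ h₂ =>
      hmono (mem i h₁ h₂.le) (mem (i + 1) (by omega) h₂) (by omega)
    obtain ⟨B, hB, hx, hz⟩ := (hf 1 (mem _ (by simp) (by simp)) 3 (mem _ (by simp) (by simp))).1
      (by simp [SameBlock, hτ])
    refine ⟨B, hB, f 1, hx, f 3, hz, f 4, ?_, f 2, ?_, lt 1 (by simp) (by simp),
      lt 2 (by simp) (by simp), lt 3 (by simp) (by simp)⟩
    · rw [← sameBlock_iff_mem hB hx, ← hf 1 (mem _ (by simp) (by simp)) 4 (mem _ (by simp) (by simp))]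
      simp [SameBlock, hτ]
    · rw [← sameBlock_iff_mem hB hx, ← hf 1 (mem _ (by simp) (by simp)) 2 (mem _ (by simp) (by simp))]
      simp [SameBlock, hτ]
  · rintro ⟨B, hB, x, hx, z, hz, w, hw, y, hy, hxy, hyz, hzw⟩
    have hxn := π.le hB hx
    have hzn := π.le hB hz
    have hwn := π.le hB hw
    have hyn : y ∈ Idx n := by
      simp only [Idx, Finset.mem_Icc] at hxn hzn ⊢
      omega
    have hyy := sameBlock_self π hyn
    have hyB : ∀ i ∈ B, ¬ SameBlock π y i := fun i hi h =>
      hy ((sameBlock_iff_mem hB hi).1 (sameBlock_comm.1 h))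
    have cases_mem : ∀ i ∈ Idx 4, i = 1 ∨ i = 2 ∨ i = 3 ∨ i = 4 := by
      intro i hi
      simp only [Idx, Finset.mem_Icc] at hi
      omega
    refine ⟨fun i => if i = 1 then x else if i = 2 then y else if i = 3 then z else w, ?_, ?_, ?_⟩
    · intro i hi j hj hij
      rcases cases_mem i hi with rfl | rfl | rfl | rfl <;>
        rcases cases_mem j hj with rfl | rfl | rfl | rfl <;> simp <;> omega
    · intro i hi
      rcases cases_mem i hi with rfl | rfl | rfl | rfl <;> simpa
    · intro i hi j hj
      rcases cases_mem i hi with rfl | rfl | rfl | rfl <;>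
        rcases cases_mem j hj with rfl | rfl | rfl | rfl <;>
        simp [sameBlock_iff_mem hB, hx, hz, hw, hy, hyy, hyB] <;> simp [SameBlock, hτ]

/-- A finite set with at least two elements is an interval together with a larger element as soon
as it has no gap below its second largest element. -/
theorem exists_eq_insert_Icc {B : Finset ℕ} (hcard : 2 ≤ B.card)
    (hgap : ∀ x ∈ B, ∀ z ∈ B, ∀ w ∈ B, ∀ y, x < y → y < z → z < w → y ∈ B) :
    ∃ a l b : ℕ, a + l + 1 ≤ b ∧ B = insert b (Finset.Icc a (a + l)) := by
  have hB : B.Nonempty := Finset.card_pos.1 (by omega)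
  obtain ⟨b, hb, hmax⟩ := B.exists_max_image id hB
  obtain ⟨a, ha, hmin⟩ := B.exists_min_image id hB
  have hE : (B.erase b).Nonempty := by
    rw [← Finset.card_pos, Finset.card_erase_of_mem hb]
    omega
  obtain ⟨c, hc, hcmax⟩ := (B.erase b).exists_max_image id hE
  simp only [Finset.mem_erase, id] at hc hcmax hmax hmin
  have hcb := hmax c hc.2
  have hac := hmin c hc.2
  refine ⟨a, c - a, b, by omega, ?_⟩
  rw [Nat.add_sub_cancel' hac]
  ext y
  simp only [Finset.mem_insert, Finset.mem_Icc]
  constructor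
  · intro hy
    by_cases hyb : y = b
    · exact Or.inl hyb
    · exact Or.inr ⟨hmin y hy, hcmax y ⟨hyb, hy⟩⟩
  · rintro (rfl | ⟨hay, hyc⟩)
    · exact hb
    · rcases hay.eq_or_lt with rfl | hay
      · exact ha
      · rcases hyc.eq_or_lt with rfl | hyc
        · exact hc.2
        · exact hgap a ha c hc.2 b hb y hay hyc (by omega)

/-- `π ⊢ [n]` avoids `134/2` iff every non-singleton block of `π` is of the form
`{a, a+1, …, a+ℓ, b}` with `b ≥ a + ℓ + 1`. -/
theorem avoids_134_2_iff (n : ℕ) (τ : Finpartition (Idx 4))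
    (hτ : τ.parts = {{1, 3, 4}, {2}})
    (π : Finpartition (Idx n)) :
    Avoids π τ ↔ ∀ B ∈ π.parts, 2 ≤ B.card →
      ∃ a l b : ℕ, a + l + 1 ≤ b ∧ B = insert b (Finset.Icc a (a + l)) := by
  rw [Avoids, contains_134_2_iff hτ]
  constructor
  · intro h B hB hcard
    refine exists_eq_insert_Icc hcard fun x hx z hz w hw y hxy hyz hzw => ?_
    by_contra hy
    exact h ⟨B, hB, x, hx, z, hz, w, hw, y, hy, hxy, hyz, hzw⟩
  · rintro h ⟨B, hB, x, hx, z, hz, w, hw, y, hy, hxy, hyz, hzw⟩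
    obtain ⟨a, l, b, hb, rfl⟩ := h B hB
      (Finset.one_lt_card.2 ⟨z, hz, w, hw, hzw.ne⟩)
    simp only [Finset.mem_insert, Finset.mem_Icc] at hx hz hw hy
    omega
end
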